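/- arXiv:math/0006203 — 11 statements merged into one kernel-verified Lean document; each statement's English description precedes it below -/
import Mathlib

section
/- Let X be a metric space, φ a flow on X, A ⊆ X a closed subset and T > 0 such that G^T(A) ⊆ int(A). Then: (a) A is an isolating neighborhood whose maximal invariant subset is I := ⋂_{S>0} G^S(A); (b) G^T(A) and Γ^T(A) are closed and the pair (G^T(A), Γ^T(A)) satisfies conditions (i) and (ii); (c) cl(G^T(A) − Γ^T(A)) is an isolating neighborhood for I, so (G^T(A), Γ^T(A)) is an index pair for I; and (d) this index pair is weakly regular: for every x ∈ Γ^T(A) there exists t ≥ 0 with φ^t(x) ∉ cl(G^T(A) − Γ^T(A)). -/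
/-- `G^T(A) = {x ∈ A | φ^{[-T,T]}(x) ⊆ A}`. -/
def Gset {X : Type*} (φ : ℝ → X → X) (T : ℝ) (A : Set X) : Set X :=
  {x ∈ A | ∀ s ∈ Set.Icc (-T) T, φ s x ∈ A}

/-- `Γ^T(A) = {x ∈ G^T(A) | φ^{[0,T]}(x) ∩ ∂A ≠ ∅}`. -/
def Γset {X : Type*} [TopologicalSpace X] (φ : ℝ → X → X) (T : ℝ) (A : Set X) : Set X :=
  {x ∈ Gset φ T A | ∃ s ∈ Set.Icc 0 T, φ s x ∈ frontier A}

/-- The maximal invariant subset of `A`: the union of all full orbits contained in `A`. -/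
def maxInv {X : Type*} (φ : ℝ → X → X) (A : Set X) : Set X :=
  {x ∈ A | ∀ t : ℝ, φ t x ∈ A}

theorem mem_Gset_iff {X : Type*} {φ : ℝ → X → X} (hφ0 : ∀ x, φ 0 x = x) {T : ℝ} (hT : 0 ≤ T)
    {A : Set X} {x : X} : x ∈ Gset φ T A ↔ ∀ s ∈ Set.Icc (-T) T, φ s x ∈ A :=
  ⟨fun h => h.2, fun h => ⟨by simpa [hφ0] using h 0 ⟨by linarith, hT⟩, h⟩⟩

theorem maxInv_eq_iInter_Gset {X : Type*} (φ : ℝ → X → X) (A : Set X) :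
    maxInv φ A = ⋂ S ∈ Set.Ioi (0 : ℝ), Gset φ S A := by
  ext x
  simp only [Set.mem_iInter, Set.mem_Ioi]
  refine ⟨fun h S _ => ⟨h.1, fun s _ => h.2 s⟩, fun h => ⟨(h 1 one_pos).1, fun t => ?_⟩⟩
  exact (h (|t| + 1) (by positivity)).2 t
    ⟨by linarith [neg_abs_le t], by linarith [le_abs_self t]⟩

theorem maxInv_subset_Gset {X : Type*} (φ : ℝ → X → X) (T : ℝ) (A : Set X) :
    maxInv φ A ⊆ Gset φ T A :=
  fun _ hx => ⟨hx.1, fun s _ => hx.2 s⟩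

theorem map_mem_maxInv {X : Type*} {φ : ℝ → X → X}
    (hφadd : ∀ s t x, φ (s + t) x = φ s (φ t x)) {A : Set X} {x : X} (hx : x ∈ maxInv φ A)
    (t : ℝ) : φ t x ∈ maxInv φ A :=
  ⟨hx.2 t, fun s => by rw [← hφadd]; exact hx.2 _⟩

theorem isClosed_Gset {X : Type*} [TopologicalSpace X] {φ : ℝ → X → X}
    (hφ : ∀ t, Continuous (φ t)) {A : Set X} (hA : IsClosed A) (T : ℝ) :
    IsClosed (Gset φ T A) := by
  have : Gset φ T A = A ∩ ⋂ s ∈ Set.Icc (-T) T, φ s ⁻¹' A := by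
    ext x; simp [Gset]
  rw [this]
  exact hA.inter (isClosed_biInter fun s _ => hA.preimage (hφ s))

/-- Points whose trajectory over a compact time set stays in an open set form an open set. -/
theorem isOpen_setOf_forall_flow_mem {X : Type*} [TopologicalSpace X] {φ : ℝ → X → X}
    (hφ : Continuous fun p : ℝ × X => φ p.1 p.2) {K : Set ℝ} (hK : IsCompact K)
    {U : Set X} (hU : IsOpen U) : IsOpen {x | ∀ s ∈ K, φ s x ∈ U} := by
  rw [isOpen_iff_mem_nhds]
  intro x hx
  refine hK.eventually_forall_of_forall_eventually fun s hs => ?_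
  have hswap : Continuous fun p : X × ℝ => φ p.2 p.1 := hφ.comp continuous_swap
  exact hswap.continuousAt.eventually_mem (hU.mem_nhds (hx s hs))

theorem isClosed_Γset {X : Type*} [TopologicalSpace X] {φ : ℝ → X → X}
    (hφ : Continuous fun p : ℝ × X => φ p.1 p.2) {A : Set X} (hA : IsClosed A) (T : ℝ) :
    IsClosed (Γset φ T A) := by
  have h : Γset φ T A = Gset φ T A ∩ {x | ∀ s ∈ Set.Icc 0 T, φ s x ∈ (frontier A)ᶜ}ᶜ := by
    ext x; simp [Γset, and_assoc]
  rw [h]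
  exact (isClosed_Gset (fun _ => hφ.comp (continuous_const.prodMk continuous_id)) hA T).inter
    (isOpen_setOf_forall_flow_mem hφ isCompact_Icc isClosed_frontier.isOpen_compl).isClosed_compl

/-- A point of `G^T(A)` outside `Γ^T(A)` stays in `G^T(A)` for a short time. -/
theorem exists_pos_forall_mem_Gset {X : Type*} [TopologicalSpace X] {φ : ℝ → X → X}
    (hφ : Continuous fun p : ℝ × X => φ p.1 p.2) (hφ0 : ∀ x, φ 0 x = x)
    (hφadd : ∀ s t x, φ (s + t) x = φ s (φ t x)) {A : Set X} {T : ℝ} (hT : 0 ≤ T) {y : X}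
    (hy : y ∈ Gset φ T A) (hyΓ : y ∉ Γset φ T A) :
    ∃ ε > 0, ∀ s ∈ Set.Icc 0 ε, φ s y ∈ Gset φ T A := by
  have hint : φ T y ∈ interior A := by
    by_contra hn
    exact hyΓ ⟨hy, T, ⟨hT, le_rfl⟩, subset_closure (hy.2 T ⟨by linarith, le_rfl⟩), hn⟩
  have hc : Continuous fun t => φ t y :=
    hφ.comp (continuous_id.prodMk continuous_const)
  obtain ⟨ε, hε, hball⟩ := Metric.mem_nhds_iff.1
    (hc.continuousAt.preimage_mem_nhds (isOpen_interior.mem_nhds hint))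
  refine ⟨ε / 2, half_pos hε, fun s hs => (mem_Gset_iff hφ0 hT).2 fun u hu => ?_⟩
  rw [← hφadd]
  rcases le_total (u + s) T with h | h
  · exact hy.2 _ ⟨by linarith [hu.1, hs.1], h⟩
  · have hmem : u + s ∈ Metric.ball T ε := by
      rw [Metric.mem_ball, Real.dist_eq, abs_of_nonneg (by linarith)]
      linarith [hu.2, hs.2]
    exact interior_subset (hball hmem)

theorem exists_mem_Γset_of_exits {X : Type*} [TopologicalSpace X] {φ : ℝ → X → X}
    (hφ : Continuous fun p : ℝ × X => φ p.1 p.2) (hφ0 : ∀ x, φ 0 x = x)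
    (hφadd : ∀ s t x, φ (s + t) x = φ s (φ t x)) {A : Set X} (hA : IsClosed A) {T : ℝ}
    (hT : 0 ≤ T) {x : X} (hx : x ∈ Gset φ T A)
    (hexit : ¬ ∀ t ≥ (0 : ℝ), φ t x ∈ Gset φ T A) :
    ∃ t ≥ (0 : ℝ), (∀ s ∈ Set.Icc 0 t, φ s x ∈ Gset φ T A) ∧ φ t x ∈ Γset φ T A := by
  by_contra! hΓ
  refine hexit fun b hb => ?_
  have hG : IsClosed (Gset φ T A) :=
    isClosed_Gset (fun _ => hφ.comp (continuous_const.prodMk continuous_id)) hA T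
  have hc : Continuous fun t => φ t x :=
    hφ.comp (continuous_id.prodMk continuous_const)
  have hclosed : IsClosed ({t | ∀ s ∈ Set.Icc 0 t, φ s x ∈ Gset φ T A} ∩ Set.Icc 0 b) := by
    have h : {t | ∀ s ∈ Set.Icc 0 t, φ s x ∈ Gset φ T A} ∩ Set.Icc 0 b =
        (⋂ c ∈ Set.Icc (0 : ℝ) 1, {t | φ (c * t) x ∈ Gset φ T A}) ∩ Set.Icc 0 b := by
      ext t
      simp only [Set.mem_inter_iff, Set.mem_iInter, Set.mem_ofPred_eq]
      refine and_congr_left fun ht => ⟨fun h c hc => ?_, fun h s hs => ?_⟩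
      · exact h _ ⟨mul_nonneg hc.1 ht.1, mul_le_of_le_one_left ht.1 hc.2⟩
      · rcases ht.1.eq_or_lt with h0 | h0
        · rwa [le_antisymm (hs.2.trans_eq h0.symm) hs.1, hφ0]
        · simpa [div_mul_cancel₀ _ h0.ne'] using
            h (s / t) ⟨div_nonneg hs.1 ht.1, div_le_one_of_le₀ hs.2 ht.1⟩
    rw [h]
    exact (isClosed_biInter fun c _ => hG.preimage (hc.comp (by fun_prop))).inter isClosed_Icc
  refine hclosed.Icc_subset_of_forall_exists_gt ?_ ?_ ⟨hb, le_rfl⟩ b ⟨hb, le_rfl⟩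
  · intro s hs
    rwa [le_antisymm hs.2 hs.1, hφ0]
  · rintro t ⟨ht, ht0, -⟩ y hy
    obtain ⟨ε, hε, h⟩ := exists_pos_forall_mem_Gset hφ hφ0 hφadd hT
      (ht t ⟨ht0, le_rfl⟩) (hΓ t ht0 ht)
    refine ⟨min (t + ε) y, fun s hs => ?_, lt_min (by linarith) hy, min_le_right _ _⟩
    rcases le_total s t with hst | hst
    · exact ht s ⟨hs.1, hst⟩
    · have := h (s - t) ⟨by linarith, by linarith [hs.2.trans (min_le_left _ _)]⟩
      rwa [← hφadd, sub_add_cancel] at this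

theorem stmt0 {X : Type*} [MetricSpace X]
    (φ : ℝ → X → X)
    (hφc : Continuous fun p : ℝ × X => φ p.1 p.2)
    (hφ0 : ∀ x, φ 0 x = x)
    (hφadd : ∀ s t x, φ (s + t) x = φ s (φ t x))
    (A : Set X) (hA : IsClosed A) (T : ℝ) (hT : 0 < T)
    (hGint : Gset φ T A ⊆ interior A) :
    -- (a) A is an isolating neighborhood whose maximal invariant subset is ⋂_{S>0} G^S(A)
    (maxInv φ A ⊆ interior A) ∧
    (maxInv φ A = ⋂ S ∈ Set.Ioi (0 : ℝ), Gset φ S A) ∧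
    -- (b) G^T(A) and Γ^T(A) are closed and (G^T(A), Γ^T(A)) satisfies (i) and (ii)
    IsClosed (Gset φ T A) ∧ IsClosed (Γset φ T A) ∧ Γset φ T A ⊆ Gset φ T A ∧
    (∀ x ∈ Γset φ T A, ∀ t ≥ (0 : ℝ),
      (∀ s ∈ Set.Icc 0 t, φ s x ∈ Gset φ T A) →
      ∀ s ∈ Set.Icc 0 t, φ s x ∈ Γset φ T A) ∧
    (∀ x ∈ Gset φ T A, ¬ (∀ t ≥ (0 : ℝ), φ t x ∈ Gset φ T A) →
      ∃ t ≥ (0 : ℝ), (∀ s ∈ Set.Icc 0 t, φ s x ∈ Gset φ T A) ∧ φ t x ∈ Γset φ T A) ∧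
    -- (c) cl(G^T(A) − Γ^T(A)) is an isolating neighborhood for I = maxInv φ A
    (maxInv φ (closure (Gset φ T A \ Γset φ T A)) = maxInv φ A) ∧
    (maxInv φ A ⊆ interior (closure (Gset φ T A \ Γset φ T A))) ∧
    -- (d) the index pair (G^T(A), Γ^T(A)) is weakly regular
    (∀ x ∈ Γset φ T A, ∃ t ≥ (0 : ℝ),
      φ t x ∉ closure (Gset φ T A \ Γset φ T A)) := by
  have hφt : ∀ t, Continuous (φ t) :=
    fun _ => hφc.comp (continuous_const.prodMk continuous_id)
  have hG := isClosed_Gset hφt hA T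
  have hclG : closure (Gset φ T A \ Γset φ T A) ⊆ Gset φ T A :=
    closure_minimal Set.sdiff_subset hG
  have hIint : maxInv φ A ⊆ interior A := (maxInv_subset_Gset φ T A).trans hGint
  have hInbhd : maxInv φ A ⊆ interior (Gset φ T A \ Γset φ T A) := by
    intro x hx
    refine mem_interior.2 ⟨{y | ∀ s ∈ Set.Icc (-T) T, φ s y ∈ interior A}, fun y hy => ⟨?_, ?_⟩,
      isOpen_setOf_forall_flow_mem hφc isCompact_Icc isOpen_interior,
      fun s _ => hIint (map_mem_maxInv hφadd hx s)⟩
    · exact (mem_Gset_iff hφ0 hT.le).2 fun s hs => interior_subset (hy s hs)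
    · rintro ⟨-, s, hs, hsA⟩
      exact hsA.2 (hy s ⟨by linarith [hs.1], hs.2⟩)
  refine ⟨hIint, maxInv_eq_iInter_Gset φ A, hG, isClosed_Γset hφc hA T, fun x hx => hx.1, ?_,
    fun x => exists_mem_Γset_of_exits hφc hφ0 hφadd hA hT.le, ?_,
    hInbhd.trans (interior_mono subset_closure), ?_⟩
  · rintro x ⟨-, r, hr, hrA⟩ t - hstay s hs
    have htr : t < r := by
      by_contra! h
      exact hrA.2 (hGint (hstay r ⟨hr.1, h⟩))
    refine ⟨hstay s hs, r - s, ⟨by linarith [hs.2], by linarith [hr.2, hs.1]⟩, ?_⟩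
    rwa [← hφadd, sub_add_cancel]
  · refine Set.Subset.antisymm (fun x hx => ⟨(hclG hx.1).1, fun t => (hclG (hx.2 t)).1⟩) ?_
    have hI : maxInv φ A ⊆ closure (Gset φ T A \ Γset φ T A) :=
      hInbhd.trans (interior_subset.trans subset_closure)
    exact fun x hx => ⟨hI hx, fun t => hI (map_mem_maxInv hφadd hx t)⟩
  · rintro x ⟨-, r, hr, hrA⟩
    exact ⟨r, hr.1, fun h => hrA.2 (hGint (hclG h))⟩
end

section
/- Let X be a metric space, φ a flow on X, A ⊆ X a closed subset and T > 0 such that G^T(A) ⊆ int(A). Then G^{2T}(A) ⊆ int(G^T(A)). -/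
/-- Points that stay in an open set along a compact set of times form an open set. -/
theorem isOpen_setOf_forall_mem_of_isCompact {S X Y : Type*} [TopologicalSpace S]
    [TopologicalSpace X] [TopologicalSpace Y] {f : S → X → Y}
    (hf : Continuous fun p : S × X => f p.1 p.2) {K : Set S} (hK : IsCompact K)
    {U : Set Y} (hU : IsOpen U) : IsOpen {x | ∀ s ∈ K, f s x ∈ U} := by
  refine isOpen_iff_eventually.2 fun x hx => ?_
  refine hK.eventually_forall_of_forall_eventually fun s hs => ?_
  exact (hf.comp continuous_swap).continuousAt.eventually (hU.mem_nhds (hx s hs))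

theorem stmt2 {X : Type*} [MetricSpace X]
    (φ : ℝ → X → X)
    (hφc : Continuous fun p : ℝ × X => φ p.1 p.2)
    (hφ0 : ∀ x, φ 0 x = x)
    (hφadd : ∀ s t x, φ (s + t) x = φ s (φ t x))
    (A : Set X) (hA : IsClosed A) (T : ℝ) (hT : 0 < T)
    (hGint : Gset φ T A ⊆ interior A) :
    Gset φ (2 * T) A ⊆ interior (Gset φ T A) := by
  have hsub : {y | ∀ s ∈ Set.Icc (-T) T, φ s y ∈ interior A} ⊆ Gset φ T A := by
    refine fun y hy => ⟨?_, fun s hs => interior_subset (hy s hs)⟩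
    simpa only [hφ0] using interior_subset (hy 0 ⟨by linarith, hT.le⟩)
  refine fun x hx => interior_maximal hsub
    (isOpen_setOf_forall_mem_of_isCompact hφc isCompact_Icc isOpen_interior) fun s hs => ?_
  refine hGint ⟨hx.2 s ⟨by linarith [hs.1], by linarith [hs.2]⟩, fun u hu => ?_⟩
  rw [← hφadd]
  exact hx.2 (u + s) ⟨by linarith [hs.1, hu.1], by linarith [hs.2, hu.2]⟩
end

section
/- Let X be a metric space, φ a flow on X, and (N,L) an index pair. If for every x ∈ L and every t > 0 one has φ^{[0,t]}(x) ⊄ cl(N − L), then the index pair (N,L) is regular, i.e. the exit time map τ_+ : N → [0,∞] is continuous. -/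
open scoped ENNReal

/-- The exit time map `τ₊ : N → [0,∞]` of the pair `(N, L)`:
`τ₊(x) = sup {t ≥ 0 | φ^{[0,t]}(x) ⊆ N − L}` for `x ∈ N − L` and `τ₊(x) = 0` for `x ∈ L`
(for `x ∈ L` the set below is empty, so the supremum is `0`). -/
noncomputable def tauPlus {X : Type*} (φ : ℝ → X → X) (N L : Set X) (x : N) : ℝ≥0∞ :=
  sSup (ENNReal.ofReal '' {r : ℝ | 0 ≤ r ∧ ∀ s ∈ Set.Icc 0 r, φ s (x : X) ∈ N \ L})

theorem lt_tauPlus_iff {X : Type*} {φ : ℝ → X → X} {N L : Set X} {x : N} {c : ℝ≥0∞} :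
    c < tauPlus φ N L x ↔
      ∃ r : ℝ, 0 ≤ r ∧ (∀ s ∈ Set.Icc 0 r, φ s (x : X) ∈ N \ L) ∧ c < ENNReal.ofReal r := by
  simp only [tauPlus, lt_sSup_iff, Set.exists_mem_image, Set.mem_ofPred_eq, and_assoc]

theorem tauPlus_le_of_notMem {X : Type*} {φ : ℝ → X → X} {N L : Set X} {x : N} {t : ℝ}
    (ht : 0 ≤ t) (h : φ t (x : X) ∉ N \ L) : tauPlus φ N L x ≤ ENNReal.ofReal t := by
  refine sSup_le ?_
  rintro _ ⟨r, ⟨-, hr⟩, rfl⟩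
  refine ENNReal.ofReal_le_ofReal (le_of_not_gt fun htr => h (hr t ⟨ht, htr.le⟩))

theorem exists_notMem_of_tauPlus_lt {X : Type*} {φ : ℝ → X → X} {N L : Set X} {x : N} {t : ℝ}
    (ht : 0 ≤ t) (h : tauPlus φ N L x < ENNReal.ofReal t) :
    ∃ s ∈ Set.Icc 0 t, φ s (x : X) ∉ N \ L := by
  by_contra! hs
  exact h.not_ge (le_sSup ⟨t, ⟨ht, hs⟩, rfl⟩)

theorem stmt3 {X : Type*} [MetricSpace X]
    (φ : ℝ → X → X)
    (hφc : Continuous fun p : ℝ × X => φ p.1 p.2)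
    (hφ0 : ∀ x, φ 0 x = x)
    (hφadd : ∀ s t x, φ (s + t) x = φ s (φ t x))
    (N L : Set X) (hN : IsClosed N) (hL : IsClosed L) (hLN : L ⊆ N)
    -- (i) L is positively invariant relative to N
    (hpos : ∀ x ∈ L, ∀ t ≥ (0 : ℝ), (∀ s ∈ Set.Icc 0 t, φ s x ∈ N) →
      ∀ s ∈ Set.Icc 0 t, φ s x ∈ L)
    -- (ii) every orbit which exits N goes through L first
    (hexit : ∀ x ∈ N, ¬ (∀ t ≥ (0 : ℝ), φ t x ∈ N) →
      ∃ t ≥ (0 : ℝ), (∀ s ∈ Set.Icc 0 t, φ s x ∈ N) ∧ φ t x ∈ L)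
    -- cl(N − L) is an isolating neighborhood
    (hiso : ∀ x ∈ closure (N \ L), (∀ t : ℝ, φ t x ∈ closure (N \ L)) →
      x ∈ interior (closure (N \ L)))
    -- the regularity criterion: for every x ∈ L and t > 0, φ^{[0,t]}(x) ⊄ cl(N − L)
    (hcrit : ∀ x ∈ L, ∀ t > (0 : ℝ), ∃ s ∈ Set.Icc 0 t, φ s x ∉ closure (N \ L)) :
    Continuous (tauPlus φ N L) := by
  rw [continuous_iff_continuousAt]
  intro x
  refine tendsto_order.2 ⟨fun c hc => ?_, fun c hc => ?_⟩
  · obtain ⟨r, hr0, hr, hcr⟩ := lt_tauPlus_iff.1 hc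
    have hcont : Continuous fun p : N × ℝ => φ p.2 (p.1 : X) :=
      hφc.comp (continuous_snd.prodMk (continuous_subtype_val.comp continuous_fst))
    have hL_avoid : ∀ᶠ y : N in nhds x, ∀ s ∈ Set.Icc 0 r, φ s (y : X) ∈ Lᶜ :=
      isCompact_Icc.eventually_forall_of_forall_eventually fun s hs =>
        hcont.continuousAt.eventually (hL.isOpen_compl.mem_nhds (hr s hs).2)
    filter_upwards [hL_avoid] with y hy
    refine lt_tauPlus_iff.2 ⟨r, hr0, fun s hs => ⟨?_, hy s hs⟩, hcr⟩
    by_contra hsN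
    obtain ⟨t, ht0, htN, htL⟩ := hexit y y.2 fun h => hsN (h s hs.1)
    have htr : r < t := lt_of_not_ge fun h => hy t ⟨ht0, h⟩ htL
    exact hsN (htN s ⟨hs.1, hs.2.trans htr.le⟩)
  · obtain ⟨b, hxb, hbc⟩ := ENNReal.lt_iff_exists_nnreal_btwn.1 hc
    obtain ⟨a, hxa, hab⟩ := ENNReal.lt_iff_exists_nnreal_btwn.1 hxb
    have hab' : (a : ℝ) < b := by exact_mod_cast hab
    obtain ⟨s, hs, hsNL⟩ := exists_notMem_of_tauPlus_lt a.2
      (by rwa [NNReal.val_eq_coe, ENNReal.ofReal_coe_nnreal])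
    obtain ⟨t, ht, htcl⟩ : ∃ t ∈ Set.Icc (0 : ℝ) b, φ t (x : X) ∉ closure (N \ L) := by
      by_cases hsN : φ s (x : X) ∈ closure (N \ L)
      · have hsL : φ s (x : X) ∈ L := by
          by_contra h
          exact hsNL ⟨closure_minimal Set.sdiff_subset hN hsN, h⟩
        obtain ⟨u, hu, hucl⟩ := hcrit _ hsL (b - a) (sub_pos.2 hab')
        refine ⟨u + s, ⟨add_nonneg hu.1 hs.1, ?_⟩, by rwa [hφadd]⟩
        have h₁ := hu.2
        have h₂ : s ≤ (a : ℝ) := hs.2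
        linarith
      · exact ⟨s, ⟨hs.1, hs.2.trans hab'.le⟩, hsN⟩
    have hcont : Continuous fun y : N => φ t (y : X) :=
      hφc.comp (continuous_const.prodMk continuous_subtype_val)
    filter_upwards [hcont.continuousAt.eventually (isClosed_closure.isOpen_compl.mem_nhds htcl)]
      with y hy
    calc tauPlus φ N L y ≤ ENNReal.ofReal t :=
          tauPlus_le_of_notMem ht.1 fun h => hy (subset_closure h)
      _ ≤ ENNReal.ofReal b := ENNReal.ofReal_le_ofReal ht.2
      _ = b := ENNReal.ofReal_coe_nnreal
      _ < c := hbc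
end

section
/- Let X be a metric space, φ a flow on X, (N,L) an index pair and V = cl(N − L). Then I^+(V) = {x ∈ V : φ^{[0,∞)}(x) ⊆ V} is a closed subset of V, and if (N,L) is weakly regular then I^+(V) ∩ L = ∅. -/
theorem stmt4 {X : Type*} [MetricSpace X]
    (φ : ℝ → X → X)
    (hφc : Continuous fun p : ℝ × X => φ p.1 p.2)
    (hφ0 : ∀ x, φ 0 x = x)
    (hφadd : ∀ s t x, φ (s + t) x = φ s (φ t x))
    (N L : Set X) (hN : IsClosed N) (hL : IsClosed L) (hLN : L ⊆ N)
    -- (i) L is positively invariant relative to N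
    (hpos : ∀ x ∈ L, ∀ t ≥ (0 : ℝ), (∀ s ∈ Set.Icc 0 t, φ s x ∈ N) →
      ∀ s ∈ Set.Icc 0 t, φ s x ∈ L)
    -- (ii) every orbit which exits N goes through L first
    (hexit : ∀ x ∈ N, ¬ (∀ t ≥ (0 : ℝ), φ t x ∈ N) →
      ∃ t ≥ (0 : ℝ), (∀ s ∈ Set.Icc 0 t, φ s x ∈ N) ∧ φ t x ∈ L)
    -- cl(N − L) is an isolating neighborhood
    (hiso : ∀ x ∈ closure (N \ L), (∀ t : ℝ, φ t x ∈ closure (N \ L)) →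
      x ∈ interior (closure (N \ L))) :
    -- I⁺(V) = {x ∈ V | φ^{[0,∞)}(x) ⊆ V} is a closed subset of V = cl(N − L)
    {x ∈ closure (N \ L) | ∀ t ≥ (0 : ℝ), φ t x ∈ closure (N \ L)} ⊆ closure (N \ L) ∧
    IsClosed {x ∈ closure (N \ L) | ∀ t ≥ (0 : ℝ), φ t x ∈ closure (N \ L)} ∧
    -- if (N, L) is weakly regular then I⁺(V) ∩ L = ∅
    ((∀ x ∈ L, ∃ t ≥ (0 : ℝ), φ t x ∉ closure (N \ L)) →
      {x ∈ closure (N \ L) | ∀ t ≥ (0 : ℝ), φ t x ∈ closure (N \ L)} ∩ L = ∅) := by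
  refine ⟨fun x hx => hx.1, ?_, fun hreg => ?_⟩
  · have hcont (t : ℝ) : Continuous (φ t) := hφc.comp (by fun_prop : Continuous fun x => (t, x))
    simp only [Set.ofPred_and, Set.ofPred_forall]
    exact isClosed_closure.inter <| isClosed_iInter fun t => isClosed_iInter fun _ =>
      isClosed_closure.preimage (hcont t)
  · refine Set.eq_empty_of_forall_notMem fun x hx => ?_
    obtain ⟨t, ht, hout⟩ := hreg x hx.2
    exact hout (hx.1.2 t ht)
end

section
/- Let X be a metric space, φ a flow on X, (N,L) a weakly regular index pair, V = cl(N − L), and let ρ : N/L → [0,1] be a continuous function with ρ^{-1}(0) = {[L]} and ρ^{-1}(1) = π(I^+(V)). Define F : N/L → [0,1] by F(ξ) = sup_{t ≥ 0} ρ(φ_♯^t(ξ)). Then F is continuous, F^{-1}(0) = {[L]}, F^{-1}(1) = π(I^+(V)), and F(φ_♯^t(ξ)) ≤ F(ξ) for all ξ ∈ N/L and t ≥ 0. -/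
/-- The setoid on `N` collapsing the subset `L` to a single point, so that
`Quotient (collapse N L)` is the quotient space `N/L` with the quotient topology. -/
def collapse {X : Type*} (N L : Set X) : Setoid N where
  r x y := x = y ∨ ((x : X) ∈ L ∧ (y : X) ∈ L)
  iseqv := by
    refine ⟨fun x => Or.inl rfl, ?_, ?_⟩
    · rintro x y (rfl | ⟨h1, h2⟩)
      · exact Or.inl rfl
      · exact Or.inr ⟨h2, h1⟩
    · rintro x y z (rfl | ⟨h1, h2⟩) (rfl | ⟨h3, h4⟩)
      · exact Or.inl rfl
      · exact Or.inr ⟨h3, h4⟩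
      · exact Or.inr ⟨h1, h2⟩
      · exact Or.inr ⟨h1, h4⟩

/-- `F(ξ) = sup_{t ≥ 0} ρ(φ♯^t(ξ))`. -/
noncomputable def Fsup {X : Type*} {N L : Set X}
    (ψ : ℝ → Quotient (collapse N L) → Quotient (collapse N L))
    (ρ : Quotient (collapse N L) → ℝ) (ξ : Quotient (collapse N L)) : ℝ :=
  sSup {y : ℝ | ∃ t : ℝ, 0 ≤ t ∧ ρ (ψ t ξ) = y}

open Filter Topology
open scoped NNReal

section StoppedFlow

variable {X : Type*} {φ : ℝ → X → X} {N L : Set X}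

/-- An orbit segment which leaves `N \ L` meets the exit set `L`. -/
theorem exists_mem_exit_set
    (hexit : ∀ x ∈ N, ¬ (∀ t ≥ (0 : ℝ), φ t x ∈ N) →
      ∃ t ≥ (0 : ℝ), (∀ s ∈ Set.Icc 0 t, φ s x ∈ N) ∧ φ t x ∈ L)
    {x : X} (hx : x ∈ N) {s : ℝ} (h : ¬ ∀ r ∈ Set.Icc 0 s, φ r x ∈ N \ L) :
    ∃ r ∈ Set.Icc 0 s, φ r x ∈ L := by
  push Not at h
  obtain ⟨r, hr, hrN⟩ := h
  by_cases hN : φ r x ∈ N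
  · exact ⟨r, hr, by_contra fun hL => hrN ⟨hN, hL⟩⟩
  · obtain ⟨t, ht, htN, htL⟩ := hexit x hx fun H => hN (H r hr.1)
    have htr : t ≤ r := by
      by_contra! hlt
      exact hN (htN r ⟨hr.1, hlt.le⟩)
    exact ⟨t, ⟨ht, htr.trans hr.2⟩, htL⟩

variable [TopologicalSpace X]

/-- The set of pairs `(x, s)` such that the orbit of `x` meets a closed set `L` before time `s`
is closed. -/
theorem isClosed_setOf_orbit_meets (hφc : Continuous fun p : ℝ × X => φ p.1 p.2)
    (N : Set X) (hL : IsClosed L) :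
    IsClosed {p : N × ℝ≥0 | ∃ r ∈ Set.Icc (0 : ℝ) p.2, φ r p.1 ∈ L} := by
  have hcont : Continuous fun q : (N × ℝ≥0) × unitInterval =>
      φ ((q.2 : ℝ) * (q.1.2 : ℝ)) (q.1.1 : X) :=
    hφc.comp (f := fun q : (N × ℝ≥0) × unitInterval =>
      (((q.2 : ℝ) * (q.1.2 : ℝ), (q.1.1 : X)) : ℝ × X)) (by fun_prop)
  convert isClosedMap_fst_of_compactSpace _ (hL.preimage hcont) using 1
  ext ⟨x, s⟩
  constructor
  · rintro ⟨r, ⟨hr0, hrs⟩, hr⟩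
    rcases (NNReal.coe_nonneg s).eq_or_lt with h0 | h0
    · have hr0' : r = 0 := le_antisymm (hrs.trans h0.ge) hr0
      exact ⟨((x, s), 0), by simpa [hr0'] using hr, rfl⟩
    · refine ⟨((x, s), ⟨r / s, div_nonneg hr0 h0.le, (div_le_one h0).2 hrs⟩), ?_, rfl⟩
      simpa [div_mul_cancel₀ r h0.ne'] using hr
  · rintro ⟨⟨⟨y, t⟩, u⟩, hu, h⟩
    obtain ⟨rfl, rfl⟩ := Prod.mk.inj h
    exact ⟨u * t, ⟨mul_nonneg u.2.1 t.2, mul_le_of_le_one_left t.2 u.2.2⟩, hu⟩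

/-- A function on `N` vanishing on the exit set `L`, evaluated along the flow stopped when it
leaves `N \ L`, is jointly continuous. -/
theorem continuous_stopped (hφc : Continuous fun p : ℝ × X => φ p.1 p.2)
    (hN : IsClosed N) (hL : IsClosed L)
    (hpos : ∀ x ∈ L, ∀ t ≥ (0 : ℝ), (∀ s ∈ Set.Icc 0 t, φ s x ∈ N) →
      ∀ s ∈ Set.Icc 0 t, φ s x ∈ L)
    (hexit : ∀ x ∈ N, ¬ (∀ t ≥ (0 : ℝ), φ t x ∈ N) →
      ∃ t ≥ (0 : ℝ), (∀ s ∈ Set.Icc 0 t, φ s x ∈ N) ∧ φ t x ∈ L)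
    (hφadd : ∀ s t x, φ (s + t) x = φ s (φ t x))
    {h : X → ℝ} (hc : ContinuousOn h N) (h0 : ∀ x ∈ L, h x = 0) {G : N × ℝ≥0 → ℝ}
    (hG : ∀ p : N × ℝ≥0, (∀ r ∈ Set.Icc (0 : ℝ) p.2, φ r p.1 ∈ N \ L) → G p = h (φ p.2 p.1))
    (hG0 : ∀ p : N × ℝ≥0, ¬ (∀ r ∈ Set.Icc (0 : ℝ) p.2, φ r p.1 ∈ N \ L) → G p = 0) :
    Continuous G := by
  set A : Set (N × ℝ≥0) := {p | ∃ r ∈ Set.Icc (0 : ℝ) p.2, φ r p.1 ∈ L} with hA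
  have hAc : IsClosed A := isClosed_setOf_orbit_meets hφc N hL
  have hGA : ∀ p ∈ A, G p = 0 := fun p ⟨r, hr, hrL⟩ => hG0 p fun H => (H r hr).2 hrL
  have hstay : ∀ p ∉ A, ∀ r ∈ Set.Icc (0 : ℝ) p.2, φ r p.1 ∈ N \ L := fun p hp =>
    by_contra fun H => hp (exists_mem_exit_set hexit p.1.2 H)
  have hev : Continuous fun p : N × ℝ≥0 => φ p.2 p.1 :=
    hφc.comp (f := fun p : N × ℝ≥0 => (((p.2 : ℝ), (p.1 : X)) : ℝ × X)) (by fun_prop)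
  rw [continuous_iff_continuousAt]
  intro p
  by_cases hpN : ∀ r ∈ Set.Icc (0 : ℝ) p.2, φ r p.1 ∈ N
  · have hend : φ p.2 p.1 ∈ N := hpN _ ⟨p.2.2, le_rfl⟩
    have hGp : G p = h (φ p.2 p.1) := by
      by_cases hp : p ∈ A
      · rw [hGA p hp]
        obtain ⟨r, hr, hrL⟩ := hp
        have hmem := hpos _ hrL (p.2 - r) (sub_nonneg.2 hr.2)
          (fun s hs => by
            rw [← hφadd]
            exact hpN _ ⟨add_nonneg hs.1 hr.1, by linarith [hs.2]⟩)
          (p.2 - r) ⟨sub_nonneg.2 hr.2, le_rfl⟩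
        rw [← hφadd, sub_add_cancel] at hmem
        exact (h0 _ hmem).symm
      · exact hG p (hstay p hp)
    have hoff : Tendsto G (𝓝[Aᶜ] p) (𝓝 (G p)) := by
      rw [hGp]
      have hlim : Tendsto (fun q : N × ℝ≥0 => φ q.2 q.1) (𝓝[Aᶜ] p) (𝓝[N] (φ p.2 p.1)) :=
        tendsto_nhdsWithin_iff.2 ⟨hev.continuousAt.mono_left nhdsWithin_le_nhds,
          eventually_nhdsWithin_of_forall fun q hq => (hstay q hq _ ⟨q.2.2, le_rfl⟩).1⟩
      refine ((hc _ hend).tendsto.comp hlim).congr' ?_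
      exact eventually_nhdsWithin_of_forall fun q hq => (hG q (hstay q hq)).symm
    have hon : Tendsto G (𝓝[A] p) (𝓝 (G p)) := by
      by_cases hp : p ∈ A
      · rw [hGA p hp]
        exact tendsto_const_nhds.congr'
          (eventually_nhdsWithin_of_forall fun q hq => (hGA q hq).symm)
      · rw [notMem_closure_iff_nhdsWithin_eq_bot.1 (by rwa [hAc.closure_eq])]
        exact tendsto_bot
    rw [ContinuousAt, ← nhdsWithin_univ, ← Set.union_compl_self A, nhdsWithin_union]
    exact hon.sup hoff
  · have hev0 : ∀ᶠ q in 𝓝 p, ¬ ∀ r ∈ Set.Icc (0 : ℝ) q.2, φ r q.1 ∈ N := by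
      push Not at hpN
      obtain ⟨r, hr, hrN⟩ := hpN
      rcases hr.2.eq_or_lt with hrs | hrs
      · subst hrs
        filter_upwards [hev.continuousAt.eventually (hN.isOpen_compl.mem_nhds hrN)] with q hq H
        exact hq (H _ ⟨q.2.2, le_rfl⟩)
      · have hevr : Continuous fun q : N × ℝ≥0 => φ r q.1 :=
          hφc.comp (f := fun q : N × ℝ≥0 => ((r, (q.1 : X)) : ℝ × X)) (by fun_prop)
        have hsnd : Continuous fun q : N × ℝ≥0 => (q.2 : ℝ) := by fun_prop
        filter_upwards [hevr.continuousAt.eventually (hN.isOpen_compl.mem_nhds hrN),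
          hsnd.continuousAt.eventually (lt_mem_nhds hrs)] with q hq hlt H
        exact hq (H r ⟨hr.1, hlt.le⟩)
    have hzero : ∀ q : N × ℝ≥0, (¬ ∀ r ∈ Set.Icc (0 : ℝ) q.2, φ r q.1 ∈ N) → G q = 0 :=
      fun q hq => hG0 q fun H => hq fun r hr => (H r hr).1
    rw [ContinuousAt, hzero p hpN]
    exact tendsto_const_nhds.congr' (hev0.mono fun q hq => (hzero q hq).symm)

end StoppedFlow


theorem stmt5 {X : Type*} [MetricSpace X]
    (φ : ℝ → X → X)
    (hφc : Continuous fun p : ℝ × X => φ p.1 p.2)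
    (hφ0 : ∀ x, φ 0 x = x)
    (hφadd : ∀ s t x, φ (s + t) x = φ s (φ t x))
    (N L : Set X) (hN : IsClosed N) (hL : IsClosed L) (hLN : L ⊆ N)
    -- (i), (ii) : (N, L) is an index pair
    (hpos : ∀ x ∈ L, ∀ t ≥ (0 : ℝ), (∀ s ∈ Set.Icc 0 t, φ s x ∈ N) →
      ∀ s ∈ Set.Icc 0 t, φ s x ∈ L)
    (hexit : ∀ x ∈ N, ¬ (∀ t ≥ (0 : ℝ), φ t x ∈ N) →
      ∃ t ≥ (0 : ℝ), (∀ s ∈ Set.Icc 0 t, φ s x ∈ N) ∧ φ t x ∈ L)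
    (hiso : ∀ x ∈ closure (N \ L), (∀ t : ℝ, φ t x ∈ closure (N \ L)) →
      x ∈ interior (closure (N \ L)))
    -- (N, L) is weakly regular
    (hwr : ∀ x ∈ L, ∃ t ≥ (0 : ℝ), φ t x ∉ closure (N \ L))
    (l₀ : X) (hl₀ : l₀ ∈ L)
    -- the induced semiflow φ♯ on N/L
    (ψ : ℝ → Quotient (collapse N L) → Quotient (collapse N L))
    (hψ1 : ∀ t : ℝ, ∀ ht : 0 ≤ t, ∀ x : N,
      ∀ h : (∀ s ∈ Set.Icc 0 t, φ s (x : X) ∈ N \ L),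
      ψ t (Quotient.mk (collapse N L) x) =
        Quotient.mk (collapse N L) ⟨φ t (x : X), (h t ⟨ht, le_rfl⟩).1⟩)
    (hψ2 : ∀ t : ℝ, 0 ≤ t → ∀ x : N,
      ¬ (∀ s ∈ Set.Icc 0 t, φ s (x : X) ∈ N \ L) →
      ψ t (Quotient.mk (collapse N L) x) = Quotient.mk (collapse N L) ⟨l₀, hLN hl₀⟩)
    -- ρ : N/L → [0,1] continuous with ρ⁻¹(0) = {[L]} and ρ⁻¹(1) = π(I⁺(V))
    (ρ : Quotient (collapse N L) → ℝ) (hρc : Continuous ρ)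
    (hρ01 : ∀ ξ, ρ ξ ∈ Set.Icc (0 : ℝ) 1)
    (hρ0 : ρ ⁻¹' {0} = {Quotient.mk (collapse N L) ⟨l₀, hLN hl₀⟩})
    (hρ1 : ρ ⁻¹' {1} = {ξ | ∃ x : N, ((x : X) ∈ closure (N \ L) ∧
      ∀ t ≥ (0 : ℝ), φ t (x : X) ∈ closure (N \ L)) ∧ Quotient.mk (collapse N L) x = ξ}) :
    -- F is continuous, takes values in [0,1], F⁻¹(0) = {[L]}, F⁻¹(1) = π(I⁺(V)),
    -- and F(φ♯^t(ξ)) ≤ F(ξ) for all ξ and t ≥ 0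
    Continuous (Fsup ψ ρ) ∧
    (∀ ξ, Fsup ψ ρ ξ ∈ Set.Icc (0 : ℝ) 1) ∧
    Fsup ψ ρ ⁻¹' {0} = {Quotient.mk (collapse N L) ⟨l₀, hLN hl₀⟩} ∧
    Fsup ψ ρ ⁻¹' {1} = {ξ | ∃ x : N, ((x : X) ∈ closure (N \ L) ∧
      ∀ t ≥ (0 : ℝ), φ t (x : X) ∈ closure (N \ L)) ∧ Quotient.mk (collapse N L) x = ξ} ∧
    (∀ ξ, ∀ t ≥ (0 : ℝ), Fsup ψ ρ (ψ t ξ) ≤ Fsup ψ ρ ξ) := by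
  set o : Quotient (collapse N L) := Quotient.mk (collapse N L) ⟨l₀, hLN hl₀⟩
  have hmkL : ∀ x : N, (x : X) ∈ L → Quotient.mk (collapse N L) x = o := fun x hx =>
    Quotient.sound (Or.inr ⟨hx, hl₀⟩)
  have hρo : ρ o = 0 := by
    have : o ∈ ρ ⁻¹' {0} := by rw [hρ0]; rfl
    exact this
  have hψo : ∀ t : ℝ, 0 ≤ t → ψ t o = o := fun t ht =>
    hψ2 t ht ⟨l₀, hLN hl₀⟩ fun H => (H 0 ⟨le_rfl, ht⟩).2 (by simpa [hφ0] using hl₀)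
  have hψ0 : ∀ ξ, ψ 0 ξ = ξ := by
    intro ξ
    induction ξ using Quotient.inductionOn with
    | h x =>
      by_cases hx : (x : X) ∈ L
      · rw [show (Quotient.mk (collapse N L) x) = o from hmkL x hx]
        exact hψo 0 le_rfl
      · have hst : ∀ s ∈ Set.Icc (0 : ℝ) 0, φ s (x : X) ∈ N \ L := by
          intro s hs
          rw [le_antisymm hs.2 hs.1, hφ0]
          exact ⟨x.2, hx⟩
        rw [hψ1 0 le_rfl x hst]
        congr 1
        exact Subtype.ext (hφ0 x)
  have hψadd : ∀ s t : ℝ, 0 ≤ s → 0 ≤ t → ∀ ξ, ψ s (ψ t ξ) = ψ (s + t) ξ := by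
    intro s t hs ht ξ
    induction ξ using Quotient.inductionOn with
    | h x =>
      by_cases hx : ∀ r ∈ Set.Icc 0 t, φ r (x : X) ∈ N \ L
      · rw [hψ1 t ht x hx]
        by_cases hy : ∀ r ∈ Set.Icc 0 s, φ r (φ t (x : X)) ∈ N \ L
        · have hxy : ∀ r ∈ Set.Icc 0 (s + t), φ r (x : X) ∈ N \ L := by
            intro r hr
            rcases le_total r t with h | h
            · exact hx r ⟨hr.1, h⟩
            · have := hy (r - t) ⟨sub_nonneg.2 h, by linarith [hr.2]⟩
              rwa [← hφadd, sub_add_cancel] at this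
          rw [hψ1 s hs ⟨φ t x, _⟩ hy, hψ1 (s + t) (add_nonneg hs ht) x hxy]
          congr 1
          exact Subtype.ext (hφadd s t x).symm
        · rw [hψ2 s hs ⟨φ t x, _⟩ hy, hψ2 (s + t) (add_nonneg hs ht) x]
          refine fun H => hy fun r hr => ?_
          rw [← hφadd]
          exact H _ ⟨add_nonneg hr.1 ht, by linarith [hr.2]⟩
      · rw [hψ2 t ht x hx, hψ2 (s + t) (add_nonneg hs ht) x, hψo s hs]
        exact fun H => hx fun r hr => H r ⟨hr.1, by linarith [hr.2]⟩
  have hbdd : ∀ ξ, BddAbove {y : ℝ | ∃ t : ℝ, 0 ≤ t ∧ ρ (ψ t ξ) = y} := by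
    rintro ξ
    exact ⟨1, by rintro _ ⟨t, -, rfl⟩; exact (hρ01 _).2⟩
  have hle : ∀ ξ, ∀ t : ℝ, 0 ≤ t → ρ (ψ t ξ) ≤ Fsup ψ ρ ξ := fun ξ t ht =>
    le_csSup (hbdd ξ) ⟨t, ht, rfl⟩
  have hsup : ∀ ξ c, (∀ t : ℝ, 0 ≤ t → ρ (ψ t ξ) ≤ c) → Fsup ψ ρ ξ ≤ c := fun ξ c hc =>
    csSup_le ⟨_, 0, le_rfl, rfl⟩ (by rintro _ ⟨t, ht, rfl⟩; exact hc t ht)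
  have hρF : ∀ ξ, ρ ξ ≤ Fsup ψ ρ ξ := fun ξ => by simpa [hψ0] using hle ξ 0 le_rfl
  have hF1 : ∀ ξ, Fsup ψ ρ ξ ≤ 1 := fun ξ => hsup ξ 1 fun t _ => (hρ01 _).2
  have hFo : Fsup ψ ρ o = 0 := le_antisymm
    (hsup o 0 fun t ht => by rw [hψo t ht, hρo]) (hρo ▸ hρF o)
  have hmkc : Continuous fun x : N => ρ (Quotient.mk (collapse N L) x) :=
    hρc.comp continuous_quotient_mk'
  let G : N → ℝ≥0 → ℝ := fun x s => ρ (ψ s (Quotient.mk (collapse N L) x))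
  have hGc : Continuous (Function.uncurry G) := by
    classical
    let h : X → ℝ := fun x => if hx : x ∈ N then ρ (Quotient.mk (collapse N L) ⟨x, hx⟩) else 0
    have hc : ContinuousOn h N := by
      rw [continuousOn_iff_continuous_domRestrict]
      refine hmkc.congr fun x => ?_
      simp [h]
    refine continuous_stopped hφc hN hL hpos hexit hφadd hc ?_ ?_ ?_
    · intro x hx
      simp only [h, dif_pos (hLN hx)]
      rw [hmkL _ hx, hρo]
    · rintro ⟨x, s⟩ hs
      simp only [Function.uncurry, G, h]
      rw [hψ1 s s.2 x hs, dif_pos (hs s ⟨s.2, le_rfl⟩).1]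
    · rintro ⟨x, s⟩ hs
      simp only [Function.uncurry, G]
      rw [hψ2 s s.2 x hs, hρo]
  -- if an orbit has left `V` at time `T`, only times up to `T` matter
  have hcompact : ∀ x : N, ∀ T : ℝ≥0, φ T (x : X) ∉ closure (N \ L) →
      Fsup ψ ρ (Quotient.mk (collapse N L) x) = sSup (G x '' Set.Icc 0 T) := by
    intro x T hT
    have hb : BddAbove (G x '' Set.Icc 0 T) :=
      ⟨1, by rintro _ ⟨t, -, rfl⟩; exact (hρ01 _).2⟩
    refine le_antisymm (hsup _ _ fun t ht => ?_)
      (csSup_le ⟨_, 0, ⟨le_rfl, T.2⟩, rfl⟩ ?_)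
    · rcases le_total t T with h | h
      · exact le_csSup hb ⟨⟨t, ht⟩, ⟨ht, h⟩, rfl⟩
      · rw [hψ2 t ht x fun H => hT (subset_closure (H T ⟨T.2, h⟩)), hρo]
        exact (hρ01 _).1.trans (le_csSup hb ⟨0, ⟨le_rfl, T.2⟩, rfl⟩)
    · rintro _ ⟨t, -, rfl⟩
      exact hle _ t t.2
  have hleave : ∀ x : N, ¬ ((x : X) ∈ closure (N \ L) ∧
      ∀ t ≥ (0 : ℝ), φ t (x : X) ∈ closure (N \ L)) →
      ∃ T : ℝ≥0, φ T (x : X) ∉ closure (N \ L) := by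
    intro x hx
    by_contra! H
    exact hx ⟨by simpa [hφ0] using H 0, fun t ht => H ⟨t, ht⟩⟩
  have hρ1' : ∀ x : N, ρ (Quotient.mk (collapse N L) x) = 1 →
      ∀ t ≥ (0 : ℝ), φ t (x : X) ∈ closure (N \ L) := by
    intro x hx
    have hx' : Quotient.mk (collapse N L) x ∈ ρ ⁻¹' {1} := hx
    rw [hρ1] at hx'
    obtain ⟨y, ⟨-, hy⟩, hyx⟩ := hx'
    rcases Quotient.exact hyx with rfl | ⟨hyL, -⟩
    · exact hy
    · obtain ⟨t, ht, hty⟩ := hwr y hyL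
      exact absurd (hy t ht) hty
  refine ⟨?_, fun ξ => ⟨(hρ01 ξ).1.trans (hρF ξ), hF1 ξ⟩, ?_, ?_, ?_⟩
  · suffices hf : Continuous fun x : N => Fsup ψ ρ (Quotient.mk (collapse N L) x) from
      isQuotientMap_quotient_mk'.continuous_iff.2 hf
    rw [continuous_iff_continuousAt]
    intro x
    by_cases hx : (x : X) ∈ closure (N \ L) ∧ ∀ t ≥ (0 : ℝ), φ t (x : X) ∈ closure (N \ L)
    · have hx1 : ρ (Quotient.mk (collapse N L) x) = 1 := by
        have : Quotient.mk (collapse N L) x ∈ ρ ⁻¹' {1} := by rw [hρ1]; exact ⟨x, hx, rfl⟩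
        exact this
      have hFx : Fsup ψ ρ (Quotient.mk (collapse N L) x) = 1 :=
        le_antisymm (hF1 _) (hx1 ▸ hρF _)
      have hlim := hmkc.tendsto x
      rw [hx1] at hlim
      rw [ContinuousAt, hFx]
      exact tendsto_of_tendsto_of_tendsto_of_le_of_le hlim tendsto_const_nhds
        (fun y => hρF _) (fun y => hF1 _)
    · obtain ⟨T, hT⟩ := hleave x hx
      have hsSup : Continuous fun y : N => sSup (G y '' Set.Icc 0 T) :=
        isCompact_Icc.continuous_sSup hGc
      have hφT : Continuous fun y : N => φ T y :=
        hφc.comp (f := fun y : N => (((T : ℝ), (y : X)) : ℝ × X)) (by fun_prop)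
      refine hsSup.continuousAt.congr ?_
      filter_upwards [hφT.continuousAt.eventually (isClosed_closure.isOpen_compl.mem_nhds hT)]
        with y hy
      exact (hcompact y T hy).symm
  · refine Set.Subset.antisymm (fun ξ hξ => ?_) (fun ξ hξ => ?_)
    · rw [← hρ0]
      exact le_antisymm ((hρF ξ).trans (le_of_eq hξ)) (hρ01 ξ).1
    · rw [Set.mem_singleton_iff.1 hξ]
      exact hFo
  · refine Set.Subset.antisymm (fun ξ hξ => ?_) (fun ξ hξ => ?_)
    · induction ξ using Quotient.inductionOn with
      | h x =>
        refine ⟨x, ?_, rfl⟩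
        by_contra hx
        obtain ⟨T, hT⟩ := hleave x hx
        obtain ⟨s, -, hs⟩ := isCompact_Icc.exists_sSup_image_eq
          (Set.nonempty_Icc.2 (zero_le : 0 ≤ T))
          (hGc.comp (Continuous.prodMk_right x)).continuousOn
        have hGs : G x s = 1 := hs.symm.trans ((hcompact x T hT).symm.trans hξ)
        simp only [G] at hGs
        by_cases hst : ∀ r ∈ Set.Icc (0 : ℝ) s, φ r (x : X) ∈ N \ L
        · rw [hψ1 s s.2 x hst] at hGs
          refine hT ?_
          rcases le_total T s with h | h
          · exact subset_closure (hst T ⟨T.2, h⟩)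
          · have := hρ1' _ hGs (T - s) (sub_nonneg.2 h)
            rwa [← hφadd, sub_add_cancel] at this
        · rw [hψ2 s s.2 x hst, hρo] at hGs
          exact zero_ne_one hGs
    · rw [← hρ1] at hξ
      exact le_antisymm (hF1 ξ) ((ge_of_eq hξ).trans (hρF ξ))
  · intro ξ t ht
    refine hsup _ _ fun s hs => ?_
    rw [hψadd s t hs ht]
    exact hle ξ _ (add_nonneg hs ht)
end

section
/- Let X be a metric space, φ a flow on X, (N,L) a weakly regular index pair and V = cl(N − L). Then there exists a continuous function g : N/L → [0,1] such that (i) g^{-1}(0) = {[L]} and g^{-1}(1) = π(I^+(V)); and (ii) if 0 < g(ξ) < 1 and t > 0, then g(φ_♯^t(ξ)) < g(ξ). -/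
open scoped NNReal Topology

/-- The observable `f` along the flow `φ`, set to zero as soon as the orbit has left `A`. -/
noncomputable def killedObservable {X : Type*} (φ : ℝ → X → X) (A : Set X) (f : X → ℝ)
    (s : ℝ≥0) (x : X) : ℝ :=
  open Classical in if ∀ r ∈ Set.Icc (0 : ℝ) s, φ r x ∈ A then f (φ s x) else 0

/-- A strictly increasing weight on `[0, ∞)` with values in `(0, 1)` and limit `1`. -/
noncomputable def timeWeight (s : ℝ≥0) : ℝ := 1 - ((s : ℝ) + 2)⁻¹

lemma timeWeight_pos (s : ℝ≥0) : 0 < timeWeight s := by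
  have h : ((s : ℝ) + 2)⁻¹ < 1 := inv_lt_one_of_one_lt₀ (by linarith [s.coe_nonneg])
  unfold timeWeight
  linarith

lemma timeWeight_lt_one (s : ℝ≥0) : timeWeight s < 1 := by
  have h : 0 < ((s : ℝ) + 2)⁻¹ := by positivity
  unfold timeWeight
  linarith

lemma timeWeight_strictMono : StrictMono timeWeight := by
  intro s t hst
  have hst' : (s : ℝ) < t := hst
  have h : ((t : ℝ) + 2)⁻¹ < ((s : ℝ) + 2)⁻¹ :=
    inv_strictAnti₀ (by positivity) (by linarith)
  unfold timeWeight
  linarith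

lemma continuous_timeWeight : Continuous timeWeight := by
  unfold timeWeight
  refine continuous_const.sub (Continuous.inv₀ (by fun_prop) fun s => ?_)
  positivity

lemma exists_lt_timeWeight {a : ℝ} (ha : a < 1) : ∃ s, a < timeWeight s := by
  have hpos : 0 < (1 - a)⁻¹ := inv_pos.2 (by linarith)
  refine ⟨⟨(1 - a)⁻¹, hpos.le⟩, ?_⟩
  have h : ((1 - a)⁻¹ + 2)⁻¹ < ((1 - a)⁻¹)⁻¹ := inv_strictAnti₀ hpos (by linarith)
  rw [inv_inv] at h
  change a < 1 - ((1 - a)⁻¹ + 2)⁻¹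
  linarith

section WeightedSup

variable {Y : Type*} {F : ℝ≥0 → Y → ℝ}

lemma bddAbove_range_timeWeight_mul (hF : ∀ s y, F s y ∈ Set.Icc (0 : ℝ) 1) (y : Y) :
    BddAbove (Set.range fun s => timeWeight s * F s y) := by
  refine ⟨1, ?_⟩
  rintro _ ⟨s, rfl⟩
  exact mul_le_one₀ (timeWeight_lt_one s).le (hF s y).1 (hF s y).2

lemma timeWeight_mul_le_iSup (hF : ∀ s y, F s y ∈ Set.Icc (0 : ℝ) 1) (s : ℝ≥0) (y : Y) :
    timeWeight s * F s y ≤ ⨆ s, timeWeight s * F s y :=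
  le_ciSup (bddAbove_range_timeWeight_mul hF y) s

lemma iSup_timeWeight_mul_mem_Icc (hF : ∀ s y, F s y ∈ Set.Icc (0 : ℝ) 1) (y : Y) :
    ⨆ s, timeWeight s * F s y ∈ Set.Icc (0 : ℝ) 1 :=
  ⟨(mul_nonneg (timeWeight_pos 0).le (hF 0 y).1).trans (timeWeight_mul_le_iSup hF 0 y),
    ciSup_le fun s => mul_le_one₀ (timeWeight_lt_one s).le (hF s y).1 (hF s y).2⟩

lemma iSup_timeWeight_mul_eq_one (hF : ∀ s y, F s y ∈ Set.Icc (0 : ℝ) 1) {y : Y}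
    (hy : ∀ s, F s y = 1) : ⨆ s, timeWeight s * F s y = 1 := by
  refine le_antisymm (iSup_timeWeight_mul_mem_Icc hF y).2 (le_of_forall_lt fun a ha => ?_)
  obtain ⟨s, hs⟩ := exists_lt_timeWeight ha
  have h := timeWeight_mul_le_iSup hF s y
  rw [hy s, mul_one] at h
  exact hs.trans_le h

lemma iSup_timeWeight_mul_eq_sSup_image (hF : ∀ s y, F s y ∈ Set.Icc (0 : ℝ) 1) {y : Y} {T : ℝ≥0}
    (hT : ∀ s ≥ T, F s y = 0) :
    ⨆ s, timeWeight s * F s y = sSup ((fun s => timeWeight s * F s y) '' Set.Icc 0 T) := by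
  have hbdd : BddAbove ((fun s => timeWeight s * F s y) '' Set.Icc 0 T) :=
    (bddAbove_range_timeWeight_mul hF y).mono (Set.image_subset_range _ _)
  refine le_antisymm (ciSup_le fun s => ?_) (csSup_le ?_ ?_)
  · rcases le_total s T with hs | hs
    · exact le_csSup hbdd ⟨s, ⟨zero_le, hs⟩, rfl⟩
    · rw [hT s hs, mul_zero]
      exact (mul_nonneg (timeWeight_pos 0).le (hF 0 y).1).trans
        (le_csSup hbdd ⟨0, ⟨le_rfl, zero_le⟩, rfl⟩)
  · exact ⟨_, 0, ⟨le_rfl, zero_le⟩, rfl⟩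
  · rintro _ ⟨s, -, rfl⟩
    exact timeWeight_mul_le_iSup hF s y

variable [TopologicalSpace Y]

lemma exists_eq_iSup_timeWeight_mul (hFc : Continuous fun p : ℝ≥0 × Y => F p.1 p.2)
    (hF : ∀ s y, F s y ∈ Set.Icc (0 : ℝ) 1) {y : Y} {T : ℝ≥0} (hT : ∀ s ≥ T, F s y = 0) :
    ∃ s, ⨆ s, timeWeight s * F s y = timeWeight s * F s y := by
  have hc : Continuous fun s => timeWeight s * F s y :=
    continuous_timeWeight.mul (hFc.comp (Continuous.prodMk_left y))
  obtain ⟨s, -, hs⟩ := (isCompact_Icc (a := (0 : ℝ≥0)) (b := T)).exists_sSup_image_eq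
    ⟨0, le_rfl, zero_le⟩ hc.continuousOn
  exact ⟨s, (iSup_timeWeight_mul_eq_sSup_image hF hT).trans hs⟩

lemma continuous_iSup_timeWeight_mul (hFc : Continuous fun p : ℝ≥0 × Y => F p.1 p.2)
    (hF : ∀ s y, F s y ∈ Set.Icc (0 : ℝ) 1)
    (hdich : ∀ y, (∀ s, F s y = 1) ∨ ∃ T : ℝ≥0, ∀ᶠ z in 𝓝 y, ∀ s ≥ T, F s z = 0) :
    Continuous fun y => ⨆ s, timeWeight s * F s y := by
  rw [continuous_iff_continuousAt]
  intro y
  rcases hdich y with hy | ⟨T, hT⟩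
  · rw [ContinuousAt, iSup_timeWeight_mul_eq_one hF hy]
    refine tendsto_order.2 ⟨fun a ha => ?_, fun a ha => .of_forall fun z =>
      (iSup_timeWeight_mul_mem_Icc hF z).2.trans_lt ha⟩
    obtain ⟨s, hs⟩ := exists_lt_timeWeight ha
    have hc : Continuous fun z => timeWeight s * F s z :=
      continuous_const.mul (hFc.comp (Continuous.prodMk_right s))
    filter_upwards [hc.continuousAt.eventually_const_lt (show a < timeWeight s * F s y by
      rwa [hy s, mul_one])] with z hz
    exact hz.trans_le (timeWeight_mul_le_iSup hF s z)
  · have hc : Continuous fun z => sSup ((fun s => timeWeight s * F s z) '' Set.Icc 0 T) := by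
      refine IsCompact.continuous_sSup (f := fun z s => timeWeight s * F s z) isCompact_Icc ?_
      exact (continuous_timeWeight.comp continuous_snd).mul (hFc.comp continuous_swap)
    refine hc.continuousAt.congr ?_
    filter_upwards [hT] with z hz
    exact (iSup_timeWeight_mul_eq_sSup_image hF hz).symm

end WeightedSup

section KilledObservable

variable {X : Type*} {φ : ℝ → X → X} {f : X → ℝ}

lemma killedObservable_mem_Icc (A : Set X) (hf : ∀ x, f x ∈ Set.Icc (0 : ℝ) 1) (s : ℝ≥0) (x : X) :
    killedObservable φ A f s x ∈ Set.Icc (0 : ℝ) 1 := by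
  unfold killedObservable
  split_ifs
  · exact hf _
  · simp

lemma killedObservable_of_notMem {A : Set X} {r : ℝ} {s : ℝ≥0} {x : X} (hr : 0 ≤ r) (hrs : r ≤ s)
    (h : φ r x ∉ A) : killedObservable φ A f s x = 0 :=
  if_neg fun H => h (H r ⟨hr, hrs⟩)

lemma killedObservable_add (hφadd : ∀ s t x, φ (s + t) x = φ s (φ t x)) {A : Set X} {t : ℝ≥0}
    {x : X} (h : ∀ r ∈ Set.Icc (0 : ℝ) t, φ r x ∈ A) (s : ℝ≥0) :
    killedObservable φ A f (s + t) x = killedObservable φ A f s (φ t x) := by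
  have hiff : (∀ r ∈ Set.Icc (0 : ℝ) (s + t), φ r x ∈ A) ↔
      ∀ r ∈ Set.Icc (0 : ℝ) s, φ r (φ t x) ∈ A := by
    simp only [← hφadd]
    refine ⟨fun H r hr => H _ ⟨by linarith [hr.1, t.coe_nonneg], by linarith [hr.2]⟩,
      fun H r hr => ?_⟩
    rcases le_total r t with hrt | hrt
    · exact h r ⟨hr.1, hrt⟩
    · simpa using H (r - t) ⟨by linarith, by linarith [hr.2]⟩
  unfold killedObservable
  rw [NNReal.coe_add, hφadd]
  split_ifs with h₁ h₂ h₂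
  · rfl
  · exact absurd (hiff.1 h₁) h₂
  · exact absurd (hiff.2 h₂) h₁
  · rfl

lemma continuous_killedObservable [TopologicalSpace X]
    (hφc : Continuous fun p : ℝ × X => φ p.1 p.2)
    (hφ0 : ∀ x, φ 0 x = x) (hφadd : ∀ s t x, φ (s + t) x = φ s (φ t x))
    {N L : Set X} (hN : IsClosed N) (hL : IsClosed L)
    (hpos : ∀ x ∈ L, ∀ t ≥ (0 : ℝ), (∀ s ∈ Set.Icc 0 t, φ s x ∈ N) →
      ∀ s ∈ Set.Icc 0 t, φ s x ∈ L)
    (hexit : ∀ x ∈ N, ¬ (∀ t ≥ (0 : ℝ), φ t x ∈ N) →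
      ∃ t ≥ (0 : ℝ), (∀ s ∈ Set.Icc 0 t, φ s x ∈ N) ∧ φ t x ∈ L)
    (hf : Continuous f) (hfL : ∀ x ∈ L, f x = 0) :
    Continuous fun p : ℝ≥0 × N => killedObservable φ (N \ L) f p.1 p.2 := by
  rw [continuous_iff_continuousAt]
  rintro ⟨t, x⟩
  have hscale : Continuous fun q : (ℝ≥0 × N) × ℝ => φ (q.2 * q.1.1) q.1.2 :=
    hφc.comp (f := fun q : (ℝ≥0 × N) × ℝ => ((q.2 * q.1.1 : ℝ), (q.1.2 : X))) (by fun_prop)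
  have hend : Continuous fun p : ℝ≥0 × N => f (φ p.1 p.2) :=
    hf.comp (hφc.comp (f := fun p : ℝ≥0 × N => ((p.1 : ℝ), (p.2 : X))) (by fun_prop))
  by_cases h : ∀ r ∈ Set.Icc (0 : ℝ) t, φ r x ∈ N \ L
  · refine hend.continuousAt.congr ?_
    have hev : ∀ᶠ p : ℝ≥0 × N in 𝓝 (t, x), ∀ u ∈ Set.Icc (0 : ℝ) 1, φ (u * p.1) p.2 ∈ Lᶜ := by
      refine isCompact_Icc.eventually_forall_of_forall_eventually fun u hu => ?_
      refine hscale.continuousAt.eventually (hL.isOpen_compl.mem_nhds ?_)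
      exact (h _ ⟨mul_nonneg hu.1 t.coe_nonneg, mul_le_of_le_one_left t.coe_nonneg hu.2⟩).2
    filter_upwards [hev] with p hp
    have hnotL : ∀ r ∈ Set.Icc (0 : ℝ) p.1, φ r p.2 ∉ L := by
      intro r hr
      have := hp (r / p.1) ⟨div_nonneg hr.1 p.1.coe_nonneg, div_le_one_of_le₀ hr.2 p.1.coe_nonneg⟩
      rwa [div_mul_cancel_of_imp fun h0 => le_antisymm (h0 ▸ hr.2) hr.1] at this
    refine (if_pos fun r hr => ⟨?_, hnotL r hr⟩).symm
    by_contra hrN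
    obtain ⟨s, hs0, hsN, hsL⟩ := hexit p.2 p.2.2 fun H => hrN (H r hr.1)
    have hsr : s ≤ r := by
      by_contra! hrs
      exact hrN (hsN r ⟨hr.1, hrs.le⟩)
    exact hnotL s ⟨hs0, hsr.trans hr.2⟩ hsL
  · have hzero : killedObservable φ (N \ L) f t x = 0 := if_neg h
    by_cases hstay : ∀ r ∈ Set.Icc (0 : ℝ) t, φ r x ∈ N
    · obtain ⟨r, hr, hrL⟩ : ∃ r ∈ Set.Icc (0 : ℝ) t, φ r x ∈ L := by
        by_contra! H
        exact h fun r hr => ⟨hstay r hr, H r hr⟩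
      have htL : φ t x ∈ L := by
        have := hpos _ hrL (t - r) (sub_nonneg.2 hr.2) (fun s hs => by
          rw [← hφadd]
          exact hstay _ ⟨by linarith [hs.1, hr.1], by linarith [hs.2]⟩) (t - r)
          ⟨sub_nonneg.2 hr.2, le_rfl⟩
        rwa [← hφadd, sub_add_cancel] at this
      change Filter.Tendsto _ _ (𝓝 (killedObservable φ (N \ L) f t x))
      rw [hzero]
      have hlim := hend.norm.tendsto (t, x)
      simp only [hfL _ htL, norm_zero] at hlim
      refine squeeze_zero_norm (fun p => ?_) hlim
      unfold killedObservable
      split_ifs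
      · exact le_rfl
      · simp
    · push Not at hstay
      obtain ⟨r, hr, hrN⟩ := hstay
      have hr0 : r ≠ 0 := fun h0 => hrN (by rw [h0, hφ0]; exact x.2)
      have ht0 : (t : ℝ) ≠ 0 := fun h0 => hr0 (le_antisymm (h0 ▸ hr.2) hr.1)
      have hc : Continuous fun p : ℝ≥0 × N => φ (r / t * p.1) p.2 :=
        hscale.comp (Continuous.prodMk_left (r / t : ℝ))
      refine (continuousAt_const (y := (0 : ℝ))).congr ?_
      filter_upwards [hc.continuousAt.eventually (hN.isOpen_compl.mem_nhds
        (show φ (r / t * t) x ∈ Nᶜ by rwa [div_mul_cancel₀ _ ht0]))] with p hp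
      refine (killedObservable_of_notMem (r := r / t * p.1)
        (mul_nonneg (div_nonneg hr.1 t.coe_nonneg) p.1.coe_nonneg)
        (mul_le_of_le_one_left p.1.coe_nonneg (div_le_one_of_le₀ hr.2 t.coe_nonneg))
        fun H => hp H.1).symm

end KilledObservable

/-- Urysohn function on a metric space whose zero set is exactly the first closed set. -/
lemma exists_continuous_eq_zero_iff_eqOn_one {X : Type*} [MetricSpace X] {s t : Set X}
    (hs : IsClosed s) (hne : s.Nonempty) (ht : IsClosed t) (hst : Disjoint s t) :
    ∃ f : X → ℝ, Continuous f ∧ (∀ x, f x ∈ Set.Icc (0 : ℝ) 1) ∧ (∀ x, f x = 0 ↔ x ∈ s) ∧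
      ∀ x ∈ t, f x = 1 := by
  obtain ⟨u, hu0, hu1, hu⟩ := exists_continuous_zero_one_of_isClosed hs ht hst
  refine ⟨fun x => max (u x) (min 1 (Metric.infDist x s)), ?_, fun x => ?_, fun x => ?_,
    fun x hx => ?_⟩
  · exact u.continuous.max (continuous_const.min (Metric.continuous_infDist_pt s))
  · exact ⟨le_max_of_le_left (hu x).1, max_le (hu x).2 (min_le_left _ _)⟩
  · rw [hs.mem_iff_infDist_zero hne]
    refine ⟨fun h => ?_, fun h => ?_⟩
    · have h1 : min 1 (Metric.infDist x s) ≤ 0 := (le_max_right _ _).trans h.le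
      refine le_antisymm ?_ Metric.infDist_nonneg
      rcases min_le_iff.1 h1 with h2 | h2
      · linarith
      · exact h2
    · have hux : u x = 0 := hu0 ((hs.mem_iff_infDist_zero hne).2 h)
      simp [hux, h]
  · have hux : u x = 1 := hu1 hx
    simp [hux]


theorem stmt6 {X : Type*} [MetricSpace X]
    (φ : ℝ → X → X)
    (hφc : Continuous fun p : ℝ × X => φ p.1 p.2)
    (hφ0 : ∀ x, φ 0 x = x)
    (hφadd : ∀ s t x, φ (s + t) x = φ s (φ t x))
    (N L : Set X) (hN : IsClosed N) (hL : IsClosed L) (hLN : L ⊆ N)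
    -- (i), (ii) : (N, L) is an index pair
    (hpos : ∀ x ∈ L, ∀ t ≥ (0 : ℝ), (∀ s ∈ Set.Icc 0 t, φ s x ∈ N) →
      ∀ s ∈ Set.Icc 0 t, φ s x ∈ L)
    (hexit : ∀ x ∈ N, ¬ (∀ t ≥ (0 : ℝ), φ t x ∈ N) →
      ∃ t ≥ (0 : ℝ), (∀ s ∈ Set.Icc 0 t, φ s x ∈ N) ∧ φ t x ∈ L)
    (hiso : ∀ x ∈ closure (N \ L), (∀ t : ℝ, φ t x ∈ closure (N \ L)) →
      x ∈ interior (closure (N \ L)))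
    -- (N, L) is weakly regular
    (hwr : ∀ x ∈ L, ∃ t ≥ (0 : ℝ), φ t x ∉ closure (N \ L))
    (l₀ : X) (hl₀ : l₀ ∈ L)
    -- the induced semiflow φ♯ on N/L
    (ψ : ℝ → Quotient (collapse N L) → Quotient (collapse N L))
    (hψ1 : ∀ t : ℝ, ∀ ht : 0 ≤ t, ∀ x : N,
      ∀ h : (∀ s ∈ Set.Icc 0 t, φ s (x : X) ∈ N \ L),
      ψ t (Quotient.mk (collapse N L) x) =
        Quotient.mk (collapse N L) ⟨φ t (x : X), (h t ⟨ht, le_rfl⟩).1⟩)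
    (hψ2 : ∀ t : ℝ, 0 ≤ t → ∀ x : N,
      ¬ (∀ s ∈ Set.Icc 0 t, φ s (x : X) ∈ N \ L) →
      ψ t (Quotient.mk (collapse N L) x) = Quotient.mk (collapse N L) ⟨l₀, hLN hl₀⟩) :
    -- there is a continuous g : N/L → [0,1] with g⁻¹(0) = {[L]}, g⁻¹(1) = π(I⁺(V)),
    -- strictly decreasing along the semiflow away from the levels 0 and 1
    ∃ g : Quotient (collapse N L) → ℝ, Continuous g ∧
      (∀ ξ, g ξ ∈ Set.Icc (0 : ℝ) 1) ∧
      g ⁻¹' {0} = {Quotient.mk (collapse N L) ⟨l₀, hLN hl₀⟩} ∧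
      g ⁻¹' {1} = {ξ | ∃ x : N, ((x : X) ∈ closure (N \ L) ∧
        ∀ t ≥ (0 : ℝ), φ t (x : X) ∈ closure (N \ L)) ∧ Quotient.mk (collapse N L) x = ξ} ∧
      (∀ ξ, 0 < g ξ → g ξ < 1 → ∀ t > (0 : ℝ), g (ψ t ξ) < g ξ) := by
  set V := closure (N \ L) with hV
  have hVN : V ⊆ N := closure_minimal Set.sdiff_subset hN
  have hflow (t : ℝ) : Continuous (φ t) := hφc.comp (Continuous.prodMk_right t)
  set I : Set X := {x | ∀ t ≥ (0 : ℝ), φ t x ∈ V} with hI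
  have hIclosed : IsClosed I := by
    simp only [hI, Set.ofPred_forall]
    exact isClosed_iInter fun t => isClosed_iInter fun _ => isClosed_closure.preimage (hflow t)
  have hIL (x : X) (hx : x ∈ I) : x ∉ L := fun hxL =>
    let ⟨t, ht, htV⟩ := hwr x hxL
    htV (hx t ht)
  have hIinv (x : X) (t : ℝ) (ht : 0 ≤ t) (hx : x ∈ I) : φ t x ∈ I := fun s hs => by
    rw [← hφadd]
    exact hx _ (add_nonneg hs ht)
  have hIstay (x : X) (hx : x ∈ I) (t : ℝ) (ht : 0 ≤ t) : φ t x ∈ N \ L :=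
    ⟨hVN (hx t ht), hIL _ (hIinv x t ht hx)⟩
  obtain ⟨f, hfc, hf01, hfL, hfI⟩ := exists_continuous_eq_zero_iff_eqOn_one hL ⟨l₀, hl₀⟩ hIclosed
    (Set.disjoint_left.2 fun x hxL hxI => hIL x hxI hxL)
  let F : ℝ≥0 → N → ℝ := fun s x => killedObservable φ (N \ L) f s x
  have hFc : Continuous fun p : ℝ≥0 × N => F p.1 p.2 :=
    continuous_killedObservable hφc hφ0 hφadd hN hL hpos hexit hfc fun x hx => (hfL x).2 hx
  have hF01 (s : ℝ≥0) (x : N) : F s x ∈ Set.Icc (0 : ℝ) 1 := killedObservable_mem_Icc _ hf01 s x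
  have hFI (x : N) (hx : (x : X) ∈ I) (s : ℝ≥0) : F s x = 1 :=
    (if_pos fun r hr => hIstay x hx r hr.1).trans (hfI _ (hIinv x s s.coe_nonneg hx))
  have hFvanish (x : N) (hx : (x : X) ∉ I) : ∃ T : ℝ≥0, ∀ᶠ z in 𝓝 x, ∀ s ≥ T, F s z = 0 := by
    obtain ⟨t, ht, htV⟩ : ∃ t ≥ (0 : ℝ), φ t x ∉ V := by
      by_contra! H
      exact hx H
    refine ⟨⟨t, ht⟩, ?_⟩
    filter_upwards [((hflow t).comp continuous_subtype_val).continuousAt.eventually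
      (isClosed_closure.isOpen_compl.mem_nhds htV)] with z hz s hs
    exact killedObservable_of_notMem ht hs fun H => hz (subset_closure H)
  have hFL (x : N) (hx : (x : X) ∈ L) (s : ℝ≥0) : F s x = 0 :=
    killedObservable_of_notMem le_rfl s.coe_nonneg (by rw [hφ0]; exact fun H => H.2 hx)
  let G : N → ℝ := fun x => ⨆ s, timeWeight s * F s x
  have hGc : Continuous G := continuous_iSup_timeWeight_mul hFc hF01 fun x => by
    by_cases hx : (x : X) ∈ I
    · exact .inl (hFI x hx)
    · exact .inr (hFvanish x hx)
  have hG01 (x : N) : G x ∈ Set.Icc (0 : ℝ) 1 := iSup_timeWeight_mul_mem_Icc hF01 x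
  have hGL (x : N) (hx : (x : X) ∈ L) : G x = 0 := by simp [G, hFL x hx]
  have hGpos (x : N) (hx : (x : X) ∉ L) : 0 < G x := by
    refine lt_of_lt_of_le (mul_pos (timeWeight_pos 0) ?_) (timeWeight_mul_le_iSup hF01 0 x)
    have hF0 : F 0 x = f x := by
      refine (if_pos fun r hr => ?_).trans (by simp [hφ0])
      rw [le_antisymm hr.2 hr.1, NNReal.coe_zero, hφ0]
      exact ⟨x.2, hx⟩
    rw [hF0]
    exact lt_of_le_of_ne (hf01 x).1 fun h => hx ((hfL x).1 h.symm)
  have hGattained (x : N) (hx : (x : X) ∉ I) : ∃ s, G x = timeWeight s * F s x := by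
    obtain ⟨T, hT⟩ := hFvanish x hx
    exact exists_eq_iSup_timeWeight_mul hFc hF01 hT.self_of_nhds
  have hGone (x : N) : G x = 1 ↔ (x : X) ∈ I := by
    refine ⟨fun h => ?_, fun hx => iSup_timeWeight_mul_eq_one hF01 (hFI x hx)⟩
    by_contra hx
    obtain ⟨s, hs⟩ := hGattained x hx
    have h1 := mul_le_of_le_one_right (timeWeight_pos s).le (hF01 s x).2
    linarith [timeWeight_lt_one s]
  have hGresp : ∀ x y : N, (collapse N L).r x y → G x = G y := by
    rintro x y (rfl | ⟨hx, hy⟩)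
    · rfl
    · rw [hGL x hx, hGL y hy]
  refine ⟨Quotient.lift G hGresp, hGc.quotient_lift hGresp, ?_, ?_, ?_, ?_⟩
  · rintro ⟨x⟩
    exact hG01 x
  · ext ⟨x⟩
    refine ⟨fun h => Quotient.sound (Or.inr ⟨?_, hl₀⟩), fun h => ?_⟩
    · by_contra hx
      exact (hGpos x hx).ne' h
    · rw [Set.mem_singleton_iff.1 h]
      exact hGL _ hl₀
  · ext ξ
    constructor
    · induction ξ using Quotient.inductionOn with | _ x => ?_
      intro h
      have hx := (hGone x).1 h
      refine ⟨x, ⟨?_, hx⟩, rfl⟩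
      simpa [hφ0] using hx 0 le_rfl
    · rintro ⟨x, ⟨-, hx⟩, rfl⟩
      exact (hGone x).2 hx
  · intro ξ
    induction ξ using Quotient.inductionOn with | _ x => ?_
    intro (h0 : 0 < G x) (h1 : G x < 1) t ht
    by_cases h : ∀ s ∈ Set.Icc 0 t, φ s (x : X) ∈ N \ L
    · rw [hψ1 t ht.le x h]
      lift t to ℝ≥0 using ht.le
      set y : N := ⟨φ t x, (h t ⟨ht.le, le_rfl⟩).1⟩
      change G y < G x
      have hy : (y : X) ∉ I := fun hy => h1.ne <| (hGone x).2 fun s hs => by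
        rcases le_total s t with hst | hst
        · exact subset_closure (h s ⟨hs, hst⟩)
        · have := hy (s - t) (sub_nonneg.2 hst)
          rwa [← hφadd, sub_add_cancel] at this
      obtain ⟨s, hs⟩ := hGattained y hy
      rcases (hF01 s y).1.eq_or_lt with hz | hz
      · rwa [hs, ← hz, mul_zero]
      · have hshift : F (s + t) x = F s y := killedObservable_add hφadd h s
        calc G y = timeWeight s * F s y := hs
          _ < timeWeight (s + t) * F s y :=
            mul_lt_mul_of_pos_right (timeWeight_strictMono (lt_add_of_pos_right s ht)) hz
          _ = timeWeight (s + t) * F (s + t) x := by rw [hshift]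
          _ ≤ G x := timeWeight_mul_le_iSup hF01 (s + t) x
    · rw [hψ2 t ht.le x h]
      change G _ < G x
      rwa [hGL _ hl₀]
end

section
/- Let X be a metric space, φ a flow on X, (N,L) a weakly regular index pair and V = cl(N − L). Then there exists a continuous function g : N → [0,1] such that g^{-1}(0) = L, g^{-1}(1) = I^+(V), and for every x ∈ N with 0 < g(x) < 1 and every t > 0 with φ^{[0,t]}(x) ⊆ N − L one has g(φ^t(x)) < g(x). -/
open Set Filter Topology

/-- The supremum of `α` over the part after time `s` of the forward orbit of `x`, followed as long
as it stays in `A`. -/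
noncomputable def orbitSup {X : Type*} (φ : ℝ → X → X) (α : X → ℝ) (A : Set X) (s : ℝ) (x : X) :
    ℝ :=
  sSup (insert 0 {a | ∃ t, 0 ≤ t ∧ s ≤ t ∧ (∀ r ∈ Icc 0 t, φ r x ∈ A) ∧ a = α (φ t x)})

section orbitSup

variable {X : Type*} {φ : ℝ → X → X} {α : X → ℝ} {A : Set X}

theorem orbitSup_le {s c : ℝ} {x : X} (hc : 0 ≤ c)
    (h : ∀ t, 0 ≤ t → s ≤ t → (∀ r ∈ Icc 0 t, φ r x ∈ A) → α (φ t x) ≤ c) :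
    orbitSup φ α A s x ≤ c := by
  apply csSup_le (insert_nonempty _ _)
  rintro a (rfl | ⟨t, h0, hs, ho, rfl⟩)
  · exact hc
  · exact h t h0 hs ho

theorem bddAbove_orbitSup (h1 : ∀ x, α x ≤ 1) (s : ℝ) (x : X) :
    BddAbove (insert 0
      {a | ∃ t, 0 ≤ t ∧ s ≤ t ∧ (∀ r ∈ Icc 0 t, φ r x ∈ A) ∧ a = α (φ t x)}) := by
  refine ⟨1, ?_⟩
  rintro a (rfl | ⟨t, -, -, -, rfl⟩)
  · exact zero_le_one
  · exact h1 _

theorem orbitSup_nonneg (h1 : ∀ x, α x ≤ 1) (s : ℝ) (x : X) : 0 ≤ orbitSup φ α A s x :=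
  le_csSup (bddAbove_orbitSup h1 s x) (mem_insert _ _)

theorem orbitSup_le_one (h1 : ∀ x, α x ≤ 1) (s : ℝ) (x : X) : orbitSup φ α A s x ≤ 1 :=
  orbitSup_le zero_le_one fun _ _ _ _ => h1 _

theorem le_orbitSup (h1 : ∀ x, α x ≤ 1) {s t : ℝ} {x : X} (h0 : 0 ≤ t) (hs : s ≤ t)
    (h : ∀ r ∈ Icc 0 t, φ r x ∈ A) : α (φ t x) ≤ orbitSup φ α A s x :=
  le_csSup (bddAbove_orbitSup h1 s x) (mem_insert_of_mem _ ⟨t, h0, hs, h, rfl⟩)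

theorem exists_lt_of_lt_orbitSup {s c : ℝ} {x : X} (hc : 0 ≤ c) (h : c < orbitSup φ α A s x) :
    ∃ t, 0 ≤ t ∧ s ≤ t ∧ (∀ r ∈ Icc 0 t, φ r x ∈ A) ∧ c < α (φ t x) := by
  by_contra! H
  exact h.not_ge (orbitSup_le hc H)

theorem orbitSup_antitone (h1 : ∀ x, α x ≤ 1) (x : X) :
    Antitone fun s => orbitSup φ α A s x := fun _ _ hab =>
  orbitSup_le (orbitSup_nonneg h1 _ _) fun _ h0 hs h => le_orbitSup h1 h0 (hab.trans hs) h

theorem orbitSup_flow_le (hadd : ∀ s t x, φ (s + t) x = φ s (φ t x)) (h1 : ∀ x, α x ≤ 1)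
    {s t : ℝ} {x : X} (ht : 0 ≤ t) (h : ∀ r ∈ Icc 0 t, φ r x ∈ A) :
    orbitSup φ α A s (φ t x) ≤ orbitSup φ α A (s + t) x := by
  refine orbitSup_le (orbitSup_nonneg h1 _ _) fun r h0 hs ho => ?_
  rw [← hadd]
  refine le_orbitSup h1 (by linarith) (by linarith) fun q hq => ?_
  rcases le_total q t with hqt | hqt
  · exact h q ⟨hq.1, hqt⟩
  · have := ho (q - t) ⟨by linarith, by linarith [hq.2]⟩
    rwa [← hadd, sub_add_cancel] at this

theorem orbitSup_eq_zero_of_notMem (h1 : ∀ x, α x ≤ 1) {s T : ℝ} {x : X} (hT : 0 ≤ T)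
    (hTs : T ≤ s) (hx : φ T x ∉ A) : orbitSup φ α A s x = 0 :=
  le_antisymm (orbitSup_le le_rfl fun _ _ hs h => (hx (h T ⟨hT, hTs.trans hs⟩)).elim)
    (orbitSup_nonneg h1 _ _)

theorem eventually_orbitSup_lt [TopologicalSpace X] (hφ : Continuous fun p : ℝ × X => φ p.1 p.2)
    (hα : Continuous α) {V : Set X} (hV : IsClosed V) (hAV : A ⊆ V) {s c T : ℝ} {x : X}
    (hc : 0 < c) (hT : 0 ≤ T) (hx : φ T x ∉ V)
    (h : ∀ t, 0 ≤ t → s ≤ t → (∀ r ∈ Icc 0 t, φ r x ∈ V) → α (φ t x) < c) :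
    ∀ᶠ y in 𝓝 x, orbitSup φ α A s y < c := by
  have key : ∀ᶠ z : X × ℝ in 𝓝 (x, c), ∀ t ∈ Icc (max 0 s) T, 0 ≤ t →
      (∀ r ∈ Icc 0 t, φ r z.1 ∈ A) → α (φ t z.1) < z.2 := by
    refine isCompact_Icc.eventually_forall_of_forall_eventually fun t ht => ?_
    have ht0 : 0 ≤ t := (le_max_left _ _).trans ht.1
    by_cases ho : ∀ r ∈ Icc 0 t, φ r x ∈ V
    · have hcont : Continuous fun z : (X × ℝ) × ℝ => α (φ z.2 z.1.1) :=
        hα.comp (hφ.comp (by fun_prop : Continuous fun z : (X × ℝ) × ℝ => (z.2, z.1.1)))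
      have hlt := h t ht0 ((le_max_right _ _).trans ht.1) ho
      filter_upwards [(isOpen_lt hcont (by fun_prop :
        Continuous fun z : (X × ℝ) × ℝ => z.1.2)).mem_nhds hlt] with z hz _ _ using hz
    · push Not at ho
      obtain ⟨r, hr, hrV⟩ := ho
      have hcont : Continuous fun z : (X × ℝ) × ℝ => φ (max 0 (min r z.2)) z.1.1 :=
        hφ.comp (by fun_prop : Continuous fun z : (X × ℝ) × ℝ => (max 0 (min r z.2), z.1.1))
      have hmem : ((x, c), t) ∈ {z : (X × ℝ) × ℝ | φ (max 0 (min r z.2)) z.1.1 ∈ Vᶜ} := by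
        simpa [min_eq_left hr.2, max_eq_right hr.1] using hrV
      filter_upwards [(hV.isOpen_compl.preimage hcont).mem_nhds hmem] with z hz hz0 hzo
      exact (hz (hAV (hzo _ ⟨le_max_left _ _, max_le hz0 (min_le_right _ _)⟩))).elim
  have hexit : ∀ᶠ y in 𝓝 x, φ T y ∉ V :=
    (hφ.comp (by fun_prop : Continuous fun y : X => (T, y))).continuousAt.eventually
      (hV.isOpen_compl.mem_nhds hx)
  have key' : ∀ᶠ b in 𝓝 c, ∀ᶠ y in 𝓝 x, ∀ t ∈ Icc (max 0 s) T, 0 ≤ t →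
      (∀ r ∈ Icc 0 t, φ r y ∈ A) → α (φ t y) < b := by
    rw [nhds_prod_eq] at key
    exact (eventually_swap_iff.1 key).curry
  obtain ⟨b, ⟨hb, hb0⟩, hbc⟩ := (((key'.and (lt_mem_nhds hc)).filter_mono nhdsWithin_le_nhds).and
    (self_mem_nhdsWithin (s := Iio c))).exists
  filter_upwards [hb, hexit] with y hy hyT
  refine (orbitSup_le (le_of_lt hb0) fun t h0 hs ho => ?_).trans_lt hbc
  refine (hy t ⟨max_le h0 hs, ?_⟩ h0 ho).le
  by_contra! hTt
  exact hyT (hAV (ho T ⟨hT, hTt.le⟩))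

theorem eventually_lt_orbitSup [TopologicalSpace X] (hφ : Continuous fun p : ℝ × X => φ p.1 p.2)
    (hα : Continuous α) (h1 : ∀ x, α x ≤ 1) {N L : Set X} (hL : IsClosed L)
    (hexit : ∀ x ∈ N, ¬ (∀ t ≥ (0 : ℝ), φ t x ∈ N) →
      ∃ t ≥ (0 : ℝ), (∀ s ∈ Icc 0 t, φ s x ∈ N) ∧ φ t x ∈ L)
    {s c : ℝ} {x : X} (hc : c < orbitSup φ α (N \ L) s x) :
    ∀ᶠ y in 𝓝[N] x, c < orbitSup φ α (N \ L) s y := by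
  rcases lt_or_ge c 0 with hc0 | hc0
  · exact Eventually.of_forall fun y => hc0.trans_le (orbitSup_nonneg h1 _ _)
  obtain ⟨t, ht0, hst, ho, hct⟩ := exists_lt_of_lt_orbitSup hc0 hc
  have hav : ∀ᶠ y in 𝓝 x, ∀ r ∈ Icc 0 t, φ r y ∉ L := by
    refine isCompact_Icc.eventually_forall_of_forall_eventually fun r hr => ?_
    have hcont : Continuous fun z : X × ℝ => φ z.2 z.1 := hφ.comp continuous_swap
    exact (hL.isOpen_compl.preimage hcont).mem_nhds (ho r hr).2
  have hlt : ∀ᶠ y in 𝓝 x, c < α (φ t y) :=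
    (hα.comp (hφ.comp (by fun_prop : Continuous fun y : X => (t, y)))).continuousAt.eventually
      (lt_mem_nhds hct)
  filter_upwards [nhdsWithin_le_nhds hav, nhdsWithin_le_nhds hlt, self_mem_nhdsWithin]
    with y hyL hyc hyN
  refine hyc.trans_le (le_orbitSup h1 ht0 hst fun r hr => ⟨?_, hyL r hr⟩)
  by_contra hrN
  obtain ⟨q, hq0, hqN, hqL⟩ := hexit y hyN fun h => hrN (h r hr.1)
  rcases le_total q r with hqr | hqr
  · exact hyL q ⟨hq0, hqr.trans hr.2⟩ hqL
  · exact hrN (hqN r ⟨hr.1, hqr⟩)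

theorem exists_flow_orbitSup_lt (hadd : ∀ s t x, φ (s + t) x = φ s (φ t x)) (h1 : ∀ x, α x ≤ 1)
    {t T : ℝ} {x : X} (ht : 0 < t) (ho : ∀ r ∈ Icc 0 t, φ r x ∈ A) (hT : 0 ≤ T)
    (hx : φ T x ∉ A) (hpos : 0 < orbitSup φ α A 0 x) :
    ∃ q : ℚ, orbitSup φ α A |(q : ℝ)| (φ t x) < orbitSup φ α A |(q : ℝ)| x := by
  by_contra! H
  obtain ⟨p, hp0, hpt⟩ := exists_rat_btwn ht
  have step : ∀ n : ℕ, orbitSup φ α A 0 x ≤ orbitSup φ α A (n * p) x := by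
    intro n
    induction n with
    | zero => simp
    | succ n ih =>
      have hn : (0 : ℝ) ≤ n * p := by positivity
      have h2 := H (n * p)
      push_cast at h2
      rw [abs_of_nonneg hn] at h2
      refine ih.trans (h2.trans ((orbitSup_flow_le hadd h1 ht.le ho).trans ?_))
      refine orbitSup_antitone h1 x ?_
      push_cast
      linarith
  obtain ⟨n, hn⟩ := exists_nat_ge (T / p)
  have hTn : T ≤ n * p := (div_le_iff₀ hp0).1 hn
  have := step n
  rw [orbitSup_eq_zero_of_notMem h1 hT hTn hx] at this
  linarith

end orbitSup

theorem exists_continuous_eq_zero_iff_mem {X : Type*} [PseudoMetricSpace X] {S : Set X}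
    (hS : IsClosed S) : ∃ d : X → ℝ, Continuous d ∧ (∀ x, 0 ≤ d x) ∧ ∀ x, d x = 0 ↔ x ∈ S := by
  rcases S.eq_empty_or_nonempty with rfl | hne
  · exact ⟨fun _ => 1, continuous_const, fun _ => zero_le_one, by simp⟩
  · exact ⟨fun x => Metric.infDist x S, Metric.continuous_infDist_pt S,
      fun x => Metric.infDist_nonneg, fun x => (hS.mem_iff_infDist_zero hne).symm⟩

theorem exists_continuous_zero_one_iff_mem {X : Type*} [PseudoMetricSpace X] {S T : Set X}
    (hS : IsClosed S) (hT : IsClosed T) (hST : Disjoint S T) :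
    ∃ α : X → ℝ, Continuous α ∧ (∀ x, 0 ≤ α x) ∧ (∀ x, α x ≤ 1) ∧
      (∀ x, α x = 0 ↔ x ∈ S) ∧ ∀ x, α x = 1 ↔ x ∈ T := by
  obtain ⟨d, hd, hd0, hdS⟩ := exists_continuous_eq_zero_iff_mem hS
  obtain ⟨e, he, he0, heT⟩ := exists_continuous_eq_zero_iff_mem hT
  have hpos : ∀ x, 0 < d x + e x := by
    intro x
    refine lt_of_le_of_ne (add_nonneg (hd0 x) (he0 x)) fun h => ?_
    have h1 : d x = 0 := by linarith [hd0 x, he0 x]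
    have h2 : e x = 0 := by linarith [hd0 x, he0 x]
    exact hST.le_bot ⟨(hdS x).1 h1, (heT x).1 h2⟩
  refine ⟨fun x => d x / (d x + e x), hd.div (hd.add he) fun x => (hpos x).ne',
    fun x => div_nonneg (hd0 x) (hpos x).le, fun x => ?_, fun x => ?_, fun x => ?_⟩
  · rw [div_le_one (hpos x)]
    linarith [he0 x]
  · rw [div_eq_zero_iff, or_iff_left (hpos x).ne', hdS]
  · rw [div_eq_one_iff_eq (hpos x).ne', left_eq_add, heT]


theorem stmt7 {X : Type*} [MetricSpace X]
    (φ : ℝ → X → X)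
    (hφc : Continuous fun p : ℝ × X => φ p.1 p.2)
    (hφ0 : ∀ x, φ 0 x = x)
    (hφadd : ∀ s t x, φ (s + t) x = φ s (φ t x))
    (N L : Set X) (hN : IsClosed N) (hL : IsClosed L) (hLN : L ⊆ N)
    -- (i), (ii) : (N, L) is an index pair
    (hpos : ∀ x ∈ L, ∀ t ≥ (0 : ℝ), (∀ s ∈ Set.Icc 0 t, φ s x ∈ N) →
      ∀ s ∈ Set.Icc 0 t, φ s x ∈ L)
    (hexit : ∀ x ∈ N, ¬ (∀ t ≥ (0 : ℝ), φ t x ∈ N) →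
      ∃ t ≥ (0 : ℝ), (∀ s ∈ Set.Icc 0 t, φ s x ∈ N) ∧ φ t x ∈ L)
    (hiso : ∀ x ∈ closure (N \ L), (∀ t : ℝ, φ t x ∈ closure (N \ L)) →
      x ∈ interior (closure (N \ L)))
    -- (N, L) is weakly regular
    (hwr : ∀ x ∈ L, ∃ t ≥ (0 : ℝ), φ t x ∉ closure (N \ L)) :
    -- there is a continuous g : N → [0,1] with g⁻¹(0) = L, g⁻¹(1) = I⁺(V),
    -- strictly decreasing along the flow within N − L away from the levels 0 and 1
    ∃ g : X → ℝ, ContinuousOn g N ∧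
      (∀ x ∈ N, g x ∈ Set.Icc (0 : ℝ) 1) ∧
      {x ∈ N | g x = 0} = L ∧
      {x ∈ N | g x = 1} =
        {x ∈ closure (N \ L) | ∀ t ≥ (0 : ℝ), φ t x ∈ closure (N \ L)} ∧
      (∀ x ∈ N, 0 < g x → g x < 1 → ∀ t > (0 : ℝ),
        (∀ s ∈ Set.Icc 0 t, φ s x ∈ N \ L) → g (φ t x) < g x) := by
  set V := closure (N \ L) with hVdef
  set P := {x ∈ V | ∀ t ≥ (0 : ℝ), φ t x ∈ V} with hP
  have hVc : IsClosed V := isClosed_closure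
  have hAV : N \ L ⊆ V := subset_closure
  have hVN : V ⊆ N := closure_minimal sdiff_subset hN
  have hcont : ∀ t, Continuous (φ t) := fun t =>
    hφc.comp (by fun_prop : Continuous fun y : X => (t, y))
  have hPc : IsClosed P := by
    have : P = V ∩ ⋂ t ∈ Ici (0 : ℝ), φ t ⁻¹' V := by
      ext x
      simp [hP]
    rw [this]
    exact hVc.inter (isClosed_biInter fun t _ => hVc.preimage (hcont t))
  have hLP : Disjoint L P := by
    rw [Set.disjoint_left]
    intro x hxL hxP
    obtain ⟨t, ht, htV⟩ := hwr x hxL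
    exact htV (hxP.2 t ht)
  have hPflow : ∀ x ∈ P, ∀ t ≥ (0 : ℝ), φ t x ∈ P := fun x hx t ht =>
    ⟨hx.2 t ht, fun s hs => by rw [← hφadd]; exact hx.2 _ (add_nonneg hs ht)⟩
  have hPA : P ⊆ N \ L := fun x hx => ⟨hVN hx.1, fun h => hLP.le_bot ⟨h, hx⟩⟩
  obtain ⟨α, hα, h0, h1, hαL, hαP⟩ := exists_continuous_zero_one_iff_mem hL hPc hLP
  have hleave : ∀ x, x ∉ P → ∃ T ≥ (0 : ℝ), φ T x ∉ V := by
    intro x hx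
    by_contra! H
    exact hx ⟨by simpa [hφ0] using H 0 le_rfl, H⟩
  set K := orbitSup φ α (N \ L) with hK
  have hKP : ∀ x ∈ P, ∀ s, K s x = 1 := by
    intro x hx s
    refine le_antisymm (orbitSup_le_one h1 _ _) ?_
    rw [← (hαP _).2 (hPflow x hx (max 0 s) (le_max_left _ _))]
    exact le_orbitSup h1 (le_max_left _ _) (le_max_right _ _) fun r hr => hPA (hPflow x hx r hr.1)
  have hKL : ∀ x ∈ L, ∀ s, K s x = 0 := by
    intro x hx s
    refine le_antisymm (orbitSup_le le_rfl fun t ht _ ho => ?_) (orbitSup_nonneg h1 _ _)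
    exact ((ho 0 ⟨le_rfl, ht⟩).2 (by rwa [hφ0])).elim
  have hKpos : ∀ x ∈ N, x ∉ L → 0 < K 0 x := by
    intro x hxN hxL
    have h := le_orbitSup (φ := φ) (A := N \ L) (s := 0) (t := 0) (x := x) h1 le_rfl le_rfl
      fun r hr => by
        obtain rfl : r = 0 := le_antisymm hr.2 hr.1
        rw [hφ0]
        exact ⟨hxN, hxL⟩
    rw [hφ0] at h
    exact ((h0 x).lt_of_ne fun h => hxL ((hαL x).1 h.symm)).trans_le h
  have hKlt : ∀ x, x ∉ P → K 0 x < 1 := by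
    intro x hx
    obtain ⟨T, hT, hTV⟩ := hleave x hx
    refine (eventually_orbitSup_lt hφc hα hVc hAV zero_lt_one hT hTV
      fun t ht _ ho => (h1 _).lt_of_ne fun h => ?_).self_of_nhds
    have htP := (hαP _).1 h
    refine hTV ?_
    rcases le_total T t with hTt | hTt
    · exact ho T ⟨hT, hTt⟩
    · have := htP.2 (T - t) (sub_nonneg.2 hTt)
      rwa [← hφadd, sub_add_cancel] at this
  have hKcont : ∀ s, ContinuousOn (K s) N := by
    intro s x hxN
    refine tendsto_order.2 ⟨fun c hc => eventually_lt_orbitSup hφc hα h1 hL hexit hc,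
      fun c hc => ?_⟩
    by_cases hx : x ∈ P
    · rw [hKP x hx] at hc
      exact Eventually.of_forall fun y => (orbitSup_le_one h1 _ _).trans_lt hc
    obtain ⟨T, hT, hTV⟩ := hleave x hx
    have hc0 : 0 < c := (orbitSup_nonneg h1 _ _).trans_lt hc
    refine nhdsWithin_le_nhds (eventually_orbitSup_lt hφc hα hVc hAV hc0 hT hTV
      fun t ht hst ho => ?_)
    by_cases htL : φ t x ∈ L
    · rwa [(hαL _).2 htL]
    have hoA : ∀ r ∈ Icc 0 t, φ r x ∈ N \ L := by
      refine fun r hr => ⟨hVN (ho r hr), fun hrL => htL ?_⟩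
      have := hpos _ hrL (t - r) (sub_nonneg.2 hr.2) (fun q hq => by
        rw [← hφadd]
        exact hVN (ho (q + r) ⟨add_nonneg hq.1 hr.1, by linarith [hq.2]⟩)) (t - r)
        (right_mem_Icc.2 (sub_nonneg.2 hr.2))
      rwa [← hφadd, sub_add_cancel] at this
    exact (le_orbitSup h1 ht hst hoA).trans_lt hc
  obtain ⟨q, hq⟩ := exists_surjective_nat ℚ
  set w : ℕ → ℝ := fun n => 1 / 2 / 2 ^ n with hw
  have hwpos : ∀ n, 0 < w n := fun n => by positivity
  have hwsum : HasSum w 1 := hasSum_geometric_two' 1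
  have hnn : ∀ x n, 0 ≤ w n * K |(q n : ℝ)| x := fun x n =>
    mul_nonneg (hwpos n).le (orbitSup_nonneg h1 _ _)
  have hle : ∀ x n, w n * K |(q n : ℝ)| x ≤ w n * K 0 x := fun x n =>
    mul_le_mul_of_nonneg_left (orbitSup_antitone h1 x (abs_nonneg _)) (hwpos n).le
  have hlew : ∀ x n, w n * K |(q n : ℝ)| x ≤ w n := fun x n =>
    mul_le_of_le_one_right (hwpos n).le (orbitSup_le_one h1 _ _)
  have hsum : ∀ x, Summable fun n => w n * K |(q n : ℝ)| x := fun x =>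
    Summable.of_nonneg_of_le (hnn x) (hlew x) hwsum.summable
  have hgK : ∀ x, ∑' n, w n * K |(q n : ℝ)| x ≤ K 0 x := fun x =>
    (Summable.tsum_le_tsum (hle x) (hsum x) (hwsum.mul_right _).summable).trans_eq
      (by rw [(hwsum.mul_right _).tsum_eq, one_mul])
  have hgpos : ∀ x ∈ N, x ∉ L → 0 < ∑' n, w n * K |(q n : ℝ)| x := by
    intro x hxN hxL
    obtain ⟨n, hn⟩ := hq 0
    refine (hsum x).tsum_pos (hnn x) n (mul_pos (hwpos n) ?_)
    simpa [hn] using hKpos x hxN hxL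
  have hg1 : ∀ x ∈ P, ∑' n, w n * K |(q n : ℝ)| x = 1 := by
    intro x hx
    simp only [hKP x hx, mul_one]
    exact hwsum.tsum_eq
  refine ⟨fun x => ∑' n, w n * K |(q n : ℝ)| x, ?_, ?_, ?_, ?_, ?_⟩
  · refine continuousOn_tsum (fun n => continuousOn_const.mul (hKcont _)) hwsum.summable
      fun n x _ => ?_
    rw [Real.norm_of_nonneg (hnn x n)]
    exact hlew x n
  · exact fun x _ => ⟨tsum_nonneg (hnn x), (hgK x).trans (orbitSup_le_one h1 _ _)⟩
  · ext x
    refine ⟨fun hx => ?_, fun hx => ⟨hLN hx, by simp [hKL x hx]⟩⟩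
    by_contra hxL
    exact (hgpos x hx.1 hxL).ne' hx.2
  · ext x
    refine ⟨fun hx => ?_, fun hx => ⟨hVN hx.1, hg1 x hx⟩⟩
    by_contra hxP
    exact ((hgK x).trans_lt (hKlt x hxP)).ne hx.2
  · intro x hxN hx0 hx1 t ht ho
    have hxP : x ∉ P := fun hx => hx1.ne (hg1 x hx)
    obtain ⟨T, hT, hTV⟩ := hleave x hxP
    obtain ⟨p, hp⟩ := exists_flow_orbitSup_lt hφadd h1 ht ho hT (fun h => hTV (hAV h))
      (hx0.trans_le (hgK x))
    obtain ⟨n, rfl⟩ := hq p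
    refine Summable.tsum_lt_tsum (i := n) (fun m => ?_) (mul_lt_mul_of_pos_left hp (hwpos n))
      (hsum _) (hsum _)
    exact mul_le_mul_of_nonneg_left ((orbitSup_flow_le hφadd h1 ht.le ho).trans
      (orbitSup_antitone h1 x (by linarith))) (hwpos m).le
end

section
/- Let X be a metric space, φ a flow on X, and L ⊆ N closed subsets of X. Then the induced semiflow φ_♯ : N/L × [0,∞) → N/L is continuous if and only if the pair (N,L) satisfies conditions (i) and (ii), i.e. L is positively invariant relative to N and every orbit which exits N goes through L first. -/
open scoped NNReal

section

open Set Filter Topology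

theorem collapse_mk_eq_iff {X : Type*} {N L : Set X} {x y : N} :
    Quotient.mk (collapse N L) x = Quotient.mk (collapse N L) y ↔
      x = y ∨ ((x : X) ∈ L ∧ (y : X) ∈ L) :=
  Quotient.eq (r := collapse N L)

theorem t1Space_collapse {X : Type*} [TopologicalSpace X] [T1Space X] {N L : Set X}
    (hL : IsClosed L) : T1Space (Quotient (collapse N L)) := by
  refine ⟨fun q => ?_⟩
  induction q using Quotient.inductionOn with | _ x
  rw [← (isQuotientMap_quotient_mk' (s := collapse N L)).isClosed_preimage]
  by_cases hx : (x : X) ∈ L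
  · convert hL.preimage (continuous_subtype_val (p := (· ∈ N))) using 1
    ext y
    refine collapse_mk_eq_iff.trans ⟨?_, fun h => Or.inr ⟨h, hx⟩⟩
    rintro (rfl | h)
    exacts [hx, h.1]
  · convert isClosed_singleton (x := x) using 1
    ext y
    exact collapse_mk_eq_iff.trans ⟨fun h => h.resolve_right fun h' => hx h'.2, Or.inl⟩

/-- If a compact orbit segment lies in an open set, so do nearby segments of nearby length. -/
theorem eventually_orbit_segment_subset {X : Type*} [TopologicalSpace X] {φ : ℝ → X → X}
    (hφc : Continuous fun p : ℝ × X => φ p.1 p.2) {O : Set X} (hO : IsOpen O) {x : X} {t : ℝ}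
    (ht : 0 ≤ t) (h : ∀ s ∈ Icc 0 t, φ s x ∈ O) :
    ∀ᶠ p : X × ℝ in 𝓝 (x, t), ∀ s ∈ Icc 0 p.2, φ s p.1 ∈ O := by
  have key : ∀ᶠ p : X × ℝ in 𝓝 (x, t), ∀ u ∈ Icc (0 : ℝ) 1, φ (u * p.2) p.1 ∈ O := by
    refine isCompact_Icc.eventually_forall_of_forall_eventually fun u hu => ?_
    have hc : Continuous fun z : (X × ℝ) × ℝ => φ (z.2 * z.1.2) z.1.1 :=
      hφc.comp (by fun_prop : Continuous fun z : (X × ℝ) × ℝ => (z.2 * z.1.2, z.1.1))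
    refine hc.continuousAt.eventually_mem (hO.mem_nhds (h _ ⟨mul_nonneg hu.1 ht, ?_⟩))
    exact mul_le_of_le_one_left ht hu.2
  filter_upwards [key] with p hp s hs
  rcases hs.1.eq_or_lt with rfl | hs0
  · simpa using hp 0 (by simp)
  · have hp0 : 0 < p.2 := hs0.trans_le hs.2
    have := hp (s / p.2) ⟨by positivity, (div_le_one hp0).2 hs.2⟩
    rwa [div_mul_cancel₀ _ hp0.ne'] at this

section InducedSemiflow

variable {X : Type*} {φ : ℝ → X → X} {N L : Set X} {l₀ : N}
  {ψ : ℝ → Quotient (collapse N L) → Quotient (collapse N L)}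

theorem continuous_induced_of_index_pair [TopologicalSpace X]
    (hφc : Continuous fun p : ℝ × X => φ p.1 p.2)
    (hφadd : ∀ s t x, φ (s + t) x = φ s (φ t x))
    (hN : IsClosed N) (hL : IsClosed L) (hl₀ : (l₀ : X) ∈ L)
    (hψ1 : ∀ t : ℝ, ∀ ht : 0 ≤ t, ∀ x : N, ∀ h : (∀ s ∈ Icc 0 t, φ s (x : X) ∈ N \ L),
      ψ t (Quotient.mk _ x) = Quotient.mk _ ⟨φ t (x : X), (h t ⟨ht, le_rfl⟩).1⟩)
    (hψ2 : ∀ t : ℝ, 0 ≤ t → ∀ x : N, ¬ (∀ s ∈ Icc 0 t, φ s (x : X) ∈ N \ L) →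
      ψ t (Quotient.mk _ x) = Quotient.mk _ l₀)
    (hinv : ∀ x ∈ L, ∀ t ≥ (0 : ℝ), (∀ s ∈ Icc 0 t, φ s x ∈ N) → ∀ s ∈ Icc 0 t, φ s x ∈ L)
    (hexit : ∀ x ∈ N, ¬ (∀ t ≥ (0 : ℝ), φ t x ∈ N) →
      ∃ t ≥ (0 : ℝ), (∀ s ∈ Icc 0 t, φ s x ∈ N) ∧ φ t x ∈ L) :
    Continuous (fun p : Quotient (collapse N L) × ℝ≥0 => ψ (p.2 : ℝ) p.1) := by
  have hq := isQuotientMap_quotient_mk' (s := collapse N L)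
  refine hq.continuous_lift_prod_left (continuous_iff_continuousAt.2 ?_)
  rintro ⟨x, t⟩ U hU
  have hcoe : Continuous fun p : N × ℝ≥0 => ((p.1 : X), (p.2 : ℝ)) := by fun_prop
  have hend : Continuous fun p : N × ℝ≥0 => φ p.2 p.1 :=
    hφc.comp (by fun_prop : Continuous fun p : N × ℝ≥0 => ((p.2 : ℝ), (p.1 : X)))
  obtain ⟨U', hU'U, hU'o, hU'm⟩ := mem_nhds_iff.1 hU
  obtain ⟨V, hVo, hV⟩ := isOpen_induced_iff.1 (hU'o.preimage hq.continuous)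
  have hVU (y : N) : (y : X) ∈ V ↔ Quotient.mk (collapse N L) y ∈ U' := Set.ext_iff.1 hV y
  change ψ t (Quotient.mk _ x) ∈ U' at hU'm
  change ∀ᶠ p : N × ℝ≥0 in 𝓝 (x, t), ψ p.2 (Quotient.mk _ p.1) ∈ U
  by_cases h : ∀ s ∈ Icc 0 (t : ℝ), φ s (x : X) ∈ N \ L
  · have hseg := (hcoe.tendsto (x, t)).eventually
      (eventually_orbit_segment_subset hφc hL.isOpen_compl t.2 fun s hs => (h s hs).2)
    rw [hψ1 t t.2 x h, ← hVU] at hU'm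
    filter_upwards [hseg, hend.continuousAt.eventually_mem (hVo.mem_nhds hU'm)]
      with ⟨y, r⟩ hy hyV
    have hyN : ∀ s ∈ Icc 0 (r : ℝ), φ s (y : X) ∈ N := by
      by_contra! hcon
      obtain ⟨s, hs, hsN⟩ := hcon
      obtain ⟨t', ht', ht'N, ht'L⟩ := hexit y y.2 fun hall => hsN (hall s hs.1)
      rcases le_total t' r with hle | hle
      · exact hy t' ⟨ht', hle⟩ ht'L
      · exact hsN (ht'N s ⟨hs.1, hs.2.trans hle⟩)
    rw [hψ1 r r.2 y fun s hs => ⟨hyN s hs, hy s hs⟩]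
    exact hU'U ((hVU _).1 hyV)
  · rw [hψ2 t t.2 x h] at hU'm
    by_cases hxN : ∀ s ∈ Icc 0 (t : ℝ), φ s (x : X) ∈ N
    · have hxL : φ t (x : X) ∈ L := by
        by_contra hcon
        refine h fun s hs => ⟨hxN s hs, fun hsL => hcon ?_⟩
        have := hinv _ hsL (t - s) (sub_nonneg.2 hs.2) (fun r hr => by
          rw [← hφadd]
          exact hxN _ ⟨add_nonneg hr.1 hs.1, by linarith [hr.2]⟩) (t - s)
          ⟨sub_nonneg.2 hs.2, le_rfl⟩
        rwa [← hφadd, sub_add_cancel] at this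
      have hxV : φ t (x : X) ∈ V := by
        refine (hVU ⟨_, hxN t ⟨t.2, le_rfl⟩⟩).2 ?_
        rwa [collapse_mk_eq_iff.2 (Or.inr ⟨hxL, hl₀⟩)]
      filter_upwards [hend.continuousAt.eventually_mem (hVo.mem_nhds hxV)] with ⟨y, r⟩ hyV
      by_cases hy : ∀ s ∈ Icc 0 (r : ℝ), φ s (y : X) ∈ N \ L
      · rw [hψ1 r r.2 y hy]
        exact hU'U ((hVU _).1 hyV)
      · rw [hψ2 r r.2 y hy]
        exact hU'U hU'm
    · push Not at hxN
      obtain ⟨s, hs, hsN⟩ := hxN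
      have hc : Continuous fun p : N × ℝ≥0 => φ (min s p.2) p.1 :=
        hφc.comp (by fun_prop : Continuous fun p : N × ℝ≥0 => (min s (p.2 : ℝ), (p.1 : X)))
      have hmem : φ (min s t) (x : X) ∈ Nᶜ := by rwa [min_eq_left hs.2]
      filter_upwards [hc.continuousAt.eventually_mem (hN.isOpen_compl.mem_nhds hmem)]
        with ⟨y, r⟩ hyr
      rw [hψ2 r r.2 y fun hall => hyr (hall _ ⟨le_min hs.1 r.2, min_le_right _ _⟩).1]
      exact hU'U hU'm

theorem positively_invariant_of_continuous_induced [TopologicalSpace X] [T1Space X]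
    (hφc : Continuous fun p : ℝ × X => φ p.1 p.2)
    (hφ0 : ∀ x, φ 0 x = x) (hφadd : ∀ s t x, φ (s + t) x = φ s (φ t x))
    (hL : IsClosed L) (hl₀ : (l₀ : X) ∈ L)
    (hψ1 : ∀ t : ℝ, ∀ ht : 0 ≤ t, ∀ x : N, ∀ h : (∀ s ∈ Icc 0 t, φ s (x : X) ∈ N \ L),
      ψ t (Quotient.mk _ x) = Quotient.mk _ ⟨φ t (x : X), (h t ⟨ht, le_rfl⟩).1⟩)
    (hψ2 : ∀ t : ℝ, 0 ≤ t → ∀ x : N, ¬ (∀ s ∈ Icc 0 t, φ s (x : X) ∈ N \ L) →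
      ψ t (Quotient.mk _ x) = Quotient.mk _ l₀)
    (hcont : Continuous (fun p : Quotient (collapse N L) × ℝ≥0 => ψ (p.2 : ℝ) p.1))
    {x : X} (hx : x ∈ L) {t : ℝ} (hxN : ∀ s ∈ Icc 0 t, φ s x ∈ N) :
    ∀ s ∈ Icc 0 t, φ s x ∈ L := by
  have := t1Space_collapse (N := N) hL
  intro s hs
  by_contra hsL
  have hφx : Continuous fun r => φ r x := hφc.comp (by fun_prop : Continuous fun r : ℝ => (r, x))
  have hA : IsCompact (Icc 0 s ∩ (fun r => φ r x) ⁻¹' L) :=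
    isCompact_Icc.inter_right (hL.preimage hφx)
  obtain ⟨σ, ⟨hσ, hσL⟩, hσmax⟩ := hA.exists_isGreatest
    ⟨0, ⟨le_rfl, hs.1⟩, by simpa [hφ0] using hx⟩
  have hσs : σ < s := hσ.2.lt_of_ne fun h => hsL (h ▸ hσL)
  let γ : ℝ → N := fun r => ⟨φ (projIcc 0 s hs.1 r) x,
    hxN _ ⟨(projIcc 0 s hs.1 r).2.1, (projIcc 0 s hs.1 r).2.2.trans hs.2⟩⟩
  have hγ : Continuous γ := Continuous.subtype_mk
    (hφx.comp (continuous_subtype_val.comp continuous_projIcc)) _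
  have hγv {r : ℝ} (hr : r ∈ Icc 0 s) : (γ r : X) = φ r x := by
    simp [γ, projIcc_of_mem hs.1 hr]
  let g : ℝ → Quotient (collapse N L) := fun r => ψ (s - r).toNNReal (Quotient.mk _ (γ r))
  have hg : Continuous g := hcont.comp <| Continuous.prodMk
    ((isQuotientMap_quotient_mk' (s := collapse N L)).continuous.comp hγ)
    (continuous_real_toNNReal.comp (by fun_prop))
  have hgσ : g σ = Quotient.mk _ l₀ := by
    refine hψ2 _ (NNReal.coe_nonneg _) _ fun hall => (hall 0 ⟨le_rfl, NNReal.coe_nonneg _⟩).2 ?_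
    rwa [hφ0, hγv hσ]
  have hgr : ∀ᶠ r in 𝓝[>] σ, g r = Quotient.mk _ (γ s) := by
    filter_upwards [Ioo_mem_nhdsGT hσs] with r hr
    have hr' : r ∈ Icc 0 s := ⟨hσ.1.trans hr.1.le, hr.2.le⟩
    have hcoe : (((s - r).toNNReal : ℝ≥0) : ℝ) = s - r := Real.coe_toNNReal _ (sub_nonneg.2 hr.2.le)
    have hseg : ∀ u ∈ Icc 0 (s - r), φ u (γ r : X) ∈ N \ L := by
      intro u hu
      rw [hγv hr', ← hφadd]
      have hu0 : 0 ≤ u + r := add_nonneg hu.1 hr'.1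
      have hus : u + r ≤ s := by linarith [hu.2]
      refine ⟨hxN _ ⟨hu0, hus.trans hs.2⟩, fun hmem => ?_⟩
      have := hσmax ⟨⟨hu0, hus⟩, hmem⟩
      linarith [hu.1, hr.1]
    change ψ _ _ = _
    rw [hcoe, hψ1 _ (sub_nonneg.2 hr.2.le) _ hseg]
    refine congrArg _ (Subtype.ext ?_)
    change φ (s - r) (γ r : X) = γ s
    rw [hγv hr', hγv ⟨hs.1, le_rfl⟩, ← hφadd, sub_add_cancel]
  have hlim : Tendsto g (𝓝[>] σ) (𝓝 (g σ)) := hg.continuousAt.tendsto.mono_left nhdsWithin_le_nhds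
  have heq := tendsto_const_nhds_iff.1 (hlim.congr' hgr)
  rw [hgσ, collapse_mk_eq_iff] at heq
  have hγsL : (γ s : X) ∈ L := by
    rcases heq with h | h
    exacts [h ▸ hl₀, h.1]
  exact hsL (hγv ⟨hs.1, le_rfl⟩ ▸ hγsL)

theorem exits_through_of_continuous_induced [TopologicalSpace X] [T1Space X]
    (hφc : Continuous fun p : ℝ × X => φ p.1 p.2) (hφ0 : ∀ x, φ 0 x = x)
    (hN : IsClosed N) (hL : IsClosed L) (hl₀ : (l₀ : X) ∈ L)
    (hψ1 : ∀ t : ℝ, ∀ ht : 0 ≤ t, ∀ x : N, ∀ h : (∀ s ∈ Icc 0 t, φ s (x : X) ∈ N \ L),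
      ψ t (Quotient.mk _ x) = Quotient.mk _ ⟨φ t (x : X), (h t ⟨ht, le_rfl⟩).1⟩)
    (hψ2 : ∀ t : ℝ, 0 ≤ t → ∀ x : N, ¬ (∀ s ∈ Icc 0 t, φ s (x : X) ∈ N \ L) →
      ψ t (Quotient.mk _ x) = Quotient.mk _ l₀)
    (hcont : Continuous (fun p : Quotient (collapse N L) × ℝ≥0 => ψ (p.2 : ℝ) p.1))
    {x : X} (hx : x ∈ N) (hexit : ¬ ∀ t ≥ (0 : ℝ), φ t x ∈ N) :
    ∃ t ≥ (0 : ℝ), (∀ s ∈ Icc 0 t, φ s x ∈ N) ∧ φ t x ∈ L := by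
  have := t1Space_collapse (N := N) hL
  by_contra! hcon
  push Not at hexit
  obtain ⟨T, hT, hTN⟩ := hexit
  have hφx : Continuous fun r => φ r x := hφc.comp (by fun_prop : Continuous fun r : ℝ => (r, x))
  have hC : IsClosed {t : ℝ | ∀ u ∈ Icc (0 : ℝ) 1, φ (u * t) x ∈ N} := by
    simp only [ofPred_forall]
    exact isClosed_biInter fun u _ => hN.preimage (hφx.comp (continuous_const_mul u))
  obtain ⟨σ, ⟨hσ, hσN⟩, hσmax⟩ := (isCompact_Icc.inter_right hC).exists_isGreatest
    ⟨0, ⟨le_rfl, hT⟩, fun u _ => by simpa [hφ0] using hx⟩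
  have hσseg : ∀ s ∈ Icc 0 σ, φ s x ∈ N := by
    intro s hs
    rcases hσ.1.eq_or_lt with rfl | hσ0
    · rwa [le_antisymm hs.2 hs.1, hφ0]
    · have := hσN (s / σ) ⟨div_nonneg hs.1 hσ.1, (div_le_one hσ0).2 hs.2⟩
      rwa [div_mul_cancel₀ _ hσ0.ne'] at this
  have hseg : ∀ s ∈ Icc 0 σ, φ s x ∈ N \ L := fun s hs =>
    ⟨hσseg s hs, hcon s hs.1 fun r hr => hσseg r ⟨hr.1, hr.2.trans hs.2⟩⟩
  let g : ℝ → Quotient (collapse N L) := fun r => ψ r.toNNReal (Quotient.mk _ ⟨x, hx⟩)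
  have hg : Continuous g :=
    hcont.comp (Continuous.prodMk continuous_const continuous_real_toNNReal)
  have hgr : ∀ᶠ r in 𝓝[>] σ, g r = Quotient.mk _ l₀ := by
    filter_upwards [self_mem_nhdsWithin] with r hr
    have hσr : σ < r := hr
    have hr0 : 0 ≤ r := hσ.1.trans hσr.le
    refine hψ2 _ (NNReal.coe_nonneg _) _ fun hall => hσr.not_ge ?_
    rw [Real.coe_toNNReal _ hr0] at hall
    have hrT : r ≤ T := le_of_not_ge fun h => hTN (hall T ⟨hT, h⟩).1
    exact hσmax ⟨⟨hr0, hrT⟩, fun u hu =>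
      (hall _ ⟨mul_nonneg hu.1 hr0, mul_le_of_le_one_left hr0 hu.2⟩).1⟩
  have hlim : Tendsto g (𝓝[>] σ) (𝓝 (g σ)) := hg.continuousAt.tendsto.mono_left nhdsWithin_le_nhds
  have heq := tendsto_const_nhds_iff.1 (hlim.congr' hgr)
  have hgσ : g σ = Quotient.mk _ ⟨φ σ x, (hseg σ ⟨hσ.1, le_rfl⟩).1⟩ := by
    change ψ _ _ = _
    rw [Real.coe_toNNReal _ hσ.1]
    exact hψ1 σ hσ.1 ⟨x, hx⟩ hseg
  rw [hgσ, collapse_mk_eq_iff] at heq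
  refine (hseg σ ⟨hσ.1, le_rfl⟩).2 ?_
  rcases heq with h | h
  · rwa [h] at hl₀
  · exact h.2

end InducedSemiflow

end

theorem stmt9 {X : Type*} [MetricSpace X]
    (φ : ℝ → X → X)
    (hφc : Continuous fun p : ℝ × X => φ p.1 p.2)
    (hφ0 : ∀ x, φ 0 x = x)
    (hφadd : ∀ s t x, φ (s + t) x = φ s (φ t x))
    (N L : Set X) (hN : IsClosed N) (hL : IsClosed L) (hLN : L ⊆ N)
    (l₀ : X) (hl₀ : l₀ ∈ L)
    -- the induced semiflow φ♯ on N/L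
    (ψ : ℝ → Quotient (collapse N L) → Quotient (collapse N L))
    (hψ1 : ∀ t : ℝ, ∀ ht : 0 ≤ t, ∀ x : N,
      ∀ h : (∀ s ∈ Set.Icc 0 t, φ s (x : X) ∈ N \ L),
      ψ t (Quotient.mk (collapse N L) x) =
        Quotient.mk (collapse N L) ⟨φ t (x : X), (h t ⟨ht, le_rfl⟩).1⟩)
    (hψ2 : ∀ t : ℝ, 0 ≤ t → ∀ x : N,
      ¬ (∀ s ∈ Set.Icc 0 t, φ s (x : X) ∈ N \ L) →
      ψ t (Quotient.mk (collapse N L) x) = Quotient.mk (collapse N L) ⟨l₀, hLN hl₀⟩) :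
    -- φ♯ : N/L × [0,∞) → N/L is continuous
    Continuous (fun p : Quotient (collapse N L) × ℝ≥0 => ψ (p.2 : ℝ) p.1) ↔
      -- (i) L is positively invariant relative to N
      ((∀ x ∈ L, ∀ t ≥ (0 : ℝ), (∀ s ∈ Set.Icc 0 t, φ s x ∈ N) →
          ∀ s ∈ Set.Icc 0 t, φ s x ∈ L) ∧
      -- (ii) every orbit which exits N goes through L first
        (∀ x ∈ N, ¬ (∀ t ≥ (0 : ℝ), φ t x ∈ N) →
          ∃ t ≥ (0 : ℝ), (∀ s ∈ Set.Icc 0 t, φ s x ∈ N) ∧ φ t x ∈ L)) := by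
  refine ⟨fun hcont => ⟨fun x hx t _ hxN => ?_, fun x hx hexit => ?_⟩, fun h => ?_⟩
  · exact positively_invariant_of_continuous_induced hφc hφ0 hφadd hL (l₀ := ⟨l₀, hLN hl₀⟩) hl₀
      hψ1 hψ2 hcont hx hxN
  · exact exits_through_of_continuous_induced hφc hφ0 hN hL (l₀ := ⟨l₀, hLN hl₀⟩) hl₀
      hψ1 hψ2 hcont hx hexit
  · exact continuous_induced_of_index_pair hφc hφadd hN hL (l₀ := ⟨l₀, hLN hl₀⟩) hl₀
      hψ1 hψ2 h.1 h.2
end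

section
/- Under the Section 4 setup (pseudo-gradient flow φ for f on a Banach space E, index pair (N,L) with V = cl(N − L), f bounded on V, Palais–Smale in V, and no critical points of f in L ∩ V), there exists T > 0 such that for every x ∈ L one has φ^{[0,T]}(x) ⊄ V, i.e. there is s ∈ [0,T] with φ^s(x) ∉ V. -/
/-- On a closed set without critical points where the Palais–Smale condition holds and `f` is
bounded, the norm of the derivative is bounded away from zero. -/
theorem exists_pos_le_norm_fderiv_of_palaisSmale
    {E : Type*} [NormedAddCommGroup E] [NormedSpace ℝ E]
    {f : E → ℝ} (hf : ContDiff ℝ 1 f) {K : Set E} (hK : IsClosed K)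
    (hfb : ∃ C, ∀ x ∈ K, |f x| ≤ C)
    (hPS : ∀ u : ℕ → E, (∀ n, u n ∈ K) → (∃ C, ∀ n, |f (u n)| ≤ C) →
      Filter.Tendsto (fun n => ‖fderiv ℝ f (u n)‖) Filter.atTop (nhds 0) →
      ∃ x : E, ∃ σ : ℕ → ℕ, StrictMono σ ∧ Filter.Tendsto (u ∘ σ) Filter.atTop (nhds x))
    (hnc : ∀ x ∈ K, fderiv ℝ f x ≠ 0) :
    ∃ δ > (0 : ℝ), ∀ x ∈ K, δ ≤ ‖fderiv ℝ f x‖ := by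
  by_contra! h
  choose u huK hu using fun n : ℕ => h (1 / ((n : ℝ) + 1)) Nat.one_div_pos_of_nat
  have hlim : Filter.Tendsto (fun n => ‖fderiv ℝ f (u n)‖) Filter.atTop (nhds 0) :=
    squeeze_zero (fun _ => norm_nonneg _) (fun n => (hu n).le)
      tendsto_one_div_add_atTop_nhds_zero_nat
  obtain ⟨C, hC⟩ := hfb
  obtain ⟨x, σ, hσ, hx⟩ := hPS u huK ⟨C, fun n => hC _ (huK n)⟩ hlim
  have hxK : x ∈ K := hK.mem_of_tendsto hx (Filter.Eventually.of_forall fun n => huK (σ n))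
  have hcont : Continuous fun y => ‖fderiv ℝ f y‖ := (hf.continuous_fderiv one_ne_zero).norm
  have hzero : ‖fderiv ℝ f x‖ = 0 :=
    tendsto_nhds_unique ((hcont.tendsto x).comp hx) (hlim.comp hσ.tendsto_atTop)
  exact hnc x hxK (norm_eq_zero.1 hzero)

/-- If `f` grows at rate at least `c` along an integral curve of `Y` on `[0, T]`, then it grows by
at least `c * T`. -/
theorem mul_le_sub_of_le_fderiv_along_curve
    {E : Type*} [NormedAddCommGroup E] [NormedSpace ℝ E]
    {f : E → ℝ} (hf : Differentiable ℝ f) {Y : E → E} {γ : ℝ → E}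
    (hγ : ∀ t, HasDerivAt γ (Y (γ t)) t) {c T : ℝ} (hT : 0 ≤ T)
    (hc : ∀ t ∈ Set.Icc 0 T, c ≤ fderiv ℝ f (γ t) (Y (γ t))) :
    c * T ≤ f (γ T) - f (γ 0) := by
  have hd : ∀ t, HasDerivAt (f ∘ γ) (fderiv ℝ f (γ t) (Y (γ t))) t := fun t =>
    (hf (γ t)).hasFDerivAt.comp_hasDerivAt t (hγ t)
  have key := (convex_Icc 0 T).mul_sub_le_image_sub_of_le_deriv (f := f ∘ γ) (C := c)
    (fun t _ => (hd t).continuousAt.continuousWithinAt)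
    (fun t _ => (hd t).differentiableAt.differentiableWithinAt)
    (fun t ht => by rw [(hd t).deriv]; exact hc t (interior_subset ht))
    0 (Set.left_mem_Icc.2 hT) T (Set.right_mem_Icc.2 hT) hT
  simpa using key


theorem stmt12
    {E : Type*} [NormedAddCommGroup E] [NormedSpace ℝ E] [CompleteSpace E]
    (f : E → ℝ) (hf : ContDiff ℝ 1 f)
    -- α : [0,∞) → [0,∞) is strictly increasing and continuous with α(0) = 0
    (α : ℝ → ℝ) (hα1 : StrictMonoOn α (Set.Ici 0))
    (hα2 : ContinuousOn α (Set.Ici 0)) (hα3 : α 0 = 0)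
    (hα4 : ∀ r : ℝ, 0 ≤ r → 0 ≤ α r)
    -- Y is a pseudo-gradient vector field for f
    (Y : E → E) (hYb : ∃ C, ∀ x, ‖Y x‖ ≤ C)
    (hYg : ∀ x, α ‖fderiv ℝ f x‖ ≤ fderiv ℝ f x (Y x))
    (hY0 : ∀ x, fderiv ℝ f x = 0 → Y x = 0)
    -- φ is the flow of Y
    (φ : ℝ → E → E)
    (hφc : Continuous fun p : ℝ × E => φ p.1 p.2)
    (hφ0 : ∀ x, φ 0 x = x)
    (hφadd : ∀ s t x, φ (s + t) x = φ s (φ t x))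
    (hφode : ∀ x t, HasDerivAt (fun s : ℝ => φ s x) (Y (φ t x)) t)
    -- (N, L) is an index pair: closed, (i), (ii), cl(N − L) isolating
    (N L : Set E) (hN : IsClosed N) (hL : IsClosed L) (hLN : L ⊆ N)
    (hpos : ∀ x ∈ L, ∀ t ≥ (0 : ℝ), (∀ s ∈ Set.Icc 0 t, φ s x ∈ N) →
      ∀ s ∈ Set.Icc 0 t, φ s x ∈ L)
    (hexit : ∀ x ∈ N, ¬ (∀ t ≥ (0 : ℝ), φ t x ∈ N) →
      ∃ t ≥ (0 : ℝ), (∀ s ∈ Set.Icc 0 t, φ s x ∈ N) ∧ φ t x ∈ L)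
    (hiso : ∀ x ∈ closure (N \ L), (∀ t : ℝ, φ t x ∈ closure (N \ L)) →
      x ∈ interior (closure (N \ L)))
    -- f is bounded on V = cl(N − L)
    (hfb : ∃ C, ∀ x ∈ closure (N \ L), |f x| ≤ C)
    -- f satisfies the Palais–Smale condition in V
    (hPS : ∀ u : ℕ → E, (∀ n, u n ∈ closure (N \ L)) →
      (∃ C, ∀ n, |f (u n)| ≤ C) →
      Filter.Tendsto (fun n => ‖fderiv ℝ f (u n)‖) Filter.atTop (nhds 0) →
      ∃ x : E, ∃ σ : ℕ → ℕ, StrictMono σ ∧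
        Filter.Tendsto (u ∘ σ) Filter.atTop (nhds x))
    -- f has no critical points in L ∩ V
    (hnc : ∀ x ∈ L ∩ closure (N \ L), fderiv ℝ f x ≠ 0) :
    ∃ T > (0 : ℝ), ∀ x ∈ L, ∃ s ∈ Set.Icc (0 : ℝ) T, φ s x ∉ closure (N \ L) := by
  have hVN : closure (N \ L) ⊆ N := closure_minimal Set.sdiff_subset hN
  obtain ⟨C, hC⟩ := hfb
  obtain ⟨δ, hδ, hδf⟩ := exists_pos_le_norm_fderiv_of_palaisSmale hf
    (hL.inter isClosed_closure) ⟨C, fun x hx => hC x hx.2⟩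
    (fun u hu => hPS u fun n => (hu n).2) hnc
  have hαδ : 0 < α δ := hα3 ▸ hα1 Set.self_mem_Ici hδ.le hδ
  have hT : 0 < (2 * |C| + 1) / α δ := by positivity
  refine ⟨(2 * |C| + 1) / α δ, hT, fun x hx => ?_⟩
  by_contra! hV
  have hxL := hpos x hx _ hT.le fun s hs => hVN (hV s hs)
  have hgrow := mul_le_sub_of_le_fderiv_along_curve (hf.differentiable one_ne_zero)
    (hφode x) hT.le (c := α δ) fun t ht =>
      (hα1.monotoneOn hδ.le (norm_nonneg _) (hδf _ ⟨hxL t ht, hV t ht⟩)).trans (hYg _)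
  rw [mul_div_cancel₀ _ hαδ.ne'] at hgrow
  have h0 := abs_le.1 (hC _ (hV 0 (Set.left_mem_Icc.2 hT.le)))
  have h1 := abs_le.1 (hC _ (hV _ (Set.right_mem_Icc.2 hT.le)))
  linarith [le_abs_self C]
end

section
/- (Second Deformation Theorem) Under the Section 4 setup (pseudo-gradient flow φ for f on a Banach space E, index pair (N,L) with V = cl(N − L), f bounded on V, Palais–Smale in V), let c ∈ ℝ and ε₀ > 0 and suppose y_1, …, y_m are exactly the critical points of f in V ∩ f^{-1}([c − ε₀, c + ε₀]) and f(y_i) = c for all i. For each i let U_i ⊆ N − L be a neighborhood of y_i in N, and let T > 0. Then there exists ε ∈ (0, ε₀] such that (N/L)^{c−ε} ⊆ (φ_♯^T)^{-1}((N/L)^{c+ε}) ∪ ⋃_{i=1}^m π(U_i). -/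
/-- The set `(N/L)^a = {[L]} ∪ {π(x) : x ∈ N − L, f(x) ≥ a}` in the quotient `N/L`. -/
def lvl {E : Type*} (N L : Set E) (f : E → ℝ) (base : Quotient (collapse N L))
    (a : ℝ) : Set (Quotient (collapse N L)) :=
  insert base {ξ | ∃ x : N, (x : E) ∈ N \ L ∧ a ≤ f (x : E) ∧
    Quotient.mk (collapse N L) x = ξ}

theorem stmt15
    {E : Type*} [NormedAddCommGroup E] [NormedSpace ℝ E] [CompleteSpace E]
    (f : E → ℝ) (hf : ContDiff ℝ 1 f)
    -- α : [0,∞) → [0,∞) is strictly increasing and continuous with α(0) = 0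
    (α : ℝ → ℝ) (hα1 : StrictMonoOn α (Set.Ici 0))
    (hα2 : ContinuousOn α (Set.Ici 0)) (hα3 : α 0 = 0)
    (hα4 : ∀ r : ℝ, 0 ≤ r → 0 ≤ α r)
    -- Y is a pseudo-gradient vector field for f
    (Y : E → E) (hYb : ∃ C, ∀ x, ‖Y x‖ ≤ C)
    (hYg : ∀ x, α ‖fderiv ℝ f x‖ ≤ fderiv ℝ f x (Y x))
    (hY0 : ∀ x, fderiv ℝ f x = 0 → Y x = 0)
    -- φ is the flow of Y
    (φ : ℝ → E → E)
    (hφc : Continuous fun p : ℝ × E => φ p.1 p.2)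
    (hφ0 : ∀ x, φ 0 x = x)
    (hφadd : ∀ s t x, φ (s + t) x = φ s (φ t x))
    (hφode : ∀ x t, HasDerivAt (fun s : ℝ => φ s x) (Y (φ t x)) t)
    -- (N, L) is an index pair: closed, (i), (ii), cl(N − L) isolating
    (N L : Set E) (hN : IsClosed N) (hL : IsClosed L) (hLN : L ⊆ N)
    (hpos : ∀ x ∈ L, ∀ t ≥ (0 : ℝ), (∀ s ∈ Set.Icc 0 t, φ s x ∈ N) →
      ∀ s ∈ Set.Icc 0 t, φ s x ∈ L)
    (hexit : ∀ x ∈ N, ¬ (∀ t ≥ (0 : ℝ), φ t x ∈ N) →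
      ∃ t ≥ (0 : ℝ), (∀ s ∈ Set.Icc 0 t, φ s x ∈ N) ∧ φ t x ∈ L)
    (hiso : ∀ x ∈ closure (N \ L), (∀ t : ℝ, φ t x ∈ closure (N \ L)) →
      x ∈ interior (closure (N \ L)))
    -- f is bounded on V = cl(N − L)
    (hfb : ∃ C, ∀ x ∈ closure (N \ L), |f x| ≤ C)
    -- f satisfies the Palais–Smale condition in V
    (hPS : ∀ u : ℕ → E, (∀ n, u n ∈ closure (N \ L)) →
      (∃ C, ∀ n, |f (u n)| ≤ C) →
      Filter.Tendsto (fun n => ‖fderiv ℝ f (u n)‖) Filter.atTop (nhds 0) →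
      ∃ x : E, ∃ σ : ℕ → ℕ, StrictMono σ ∧
        Filter.Tendsto (u ∘ σ) Filter.atTop (nhds x))
    -- the point [L] in N/L and the induced semiflow φ♯ on N/L
    (l₀ : E) (hl₀ : l₀ ∈ L)
    (ψ : ℝ → Quotient (collapse N L) → Quotient (collapse N L))
    (hψ1 : ∀ t : ℝ, ∀ ht : 0 ≤ t, ∀ x : N,
      ∀ h : (∀ s ∈ Set.Icc 0 t, φ s (x : E) ∈ N \ L),
      ψ t (Quotient.mk (collapse N L) x) =
        Quotient.mk (collapse N L) ⟨φ t (x : E), (h t ⟨ht, le_rfl⟩).1⟩)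
    (hψ2 : ∀ t : ℝ, 0 ≤ t → ∀ x : N,
      ¬ (∀ s ∈ Set.Icc 0 t, φ s (x : E) ∈ N \ L) →
      ψ t (Quotient.mk (collapse N L) x) = Quotient.mk (collapse N L) ⟨l₀, hLN hl₀⟩)
    (c ε₀ : ℝ) (hε₀ : 0 < ε₀) (m : ℕ)
    -- y 1, …, y m are exactly the critical points of f in V ∩ f⁻¹([c − ε₀, c + ε₀])
    (y : Fin m → E) (hyinj : Function.Injective y)
    (hcrit : ∀ x : E, (x ∈ closure (N \ L) ∧ f x ∈ Set.Icc (c - ε₀) (c + ε₀) ∧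
      fderiv ℝ f x = 0) ↔ ∃ i, y i = x)
    (hyc : ∀ i, f (y i) = c)
    -- U i ⊆ N − L is a neighborhood of y i in N
    (U : Fin m → Set E) (hU1 : ∀ i, U i ⊆ N \ L)
    (hU2 : ∀ i, U i ∈ nhdsWithin (y i) N)
    (T : ℝ) (hT : 0 < T) :
    ∃ ε ∈ Set.Ioc (0 : ℝ) ε₀,
      ∀ ξ ∈ lvl N L f (Quotient.mk (collapse N L) ⟨l₀, hLN hl₀⟩) (c - ε),
        ψ T ξ ∈ lvl N L f (Quotient.mk (collapse N L) ⟨l₀, hLN hl₀⟩) (c + ε) ∨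
        ∃ i : Fin m, ∃ x : N, (x : E) ∈ U i ∧ Quotient.mk (collapse N L) x = ξ := by
  obtain ⟨C, hC⟩ := hYb
  have hderiv : ∀ x t, HasDerivAt (fun s => f (φ s x)) (fderiv ℝ f (φ t x) (Y (φ t x))) t :=
    fun x t => ((hf.differentiable one_ne_zero (φ t x)).hasFDerivAt).comp_hasDerivAt t (hφode x t)
  have hmono : ∀ x, Monotone fun s => f (φ s x) := fun x =>
    monotone_of_hasDerivAt_nonneg (hderiv x)
      fun t => (hα4 _ (norm_nonneg _)).trans (hYg _)
  have hdist : ∀ x t, 0 ≤ t → ‖φ t x - x‖ ≤ C * t := by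
    intro x t ht
    have h := norm_image_sub_le_of_norm_deriv_le_segment' (f := fun s => φ s x) (a := 0) (b := t)
      (fun s _ => (hφode x s).hasDerivWithinAt) (fun s _ => hC _) t ⟨ht, le_rfl⟩
    simpa [hφ0] using h
  by_contra! H
  let ε : ℕ → ℝ := fun n => ε₀ * (1 / ((n : ℝ) + 1)) ^ 2
  let τ : ℕ → ℝ := fun n => T * (1 / ((n : ℝ) + 1))
  have hq : ∀ n : ℕ, 0 < 1 / ((n : ℝ) + 1) ∧ 1 / ((n : ℝ) + 1) ≤ 1 := fun n =>
    ⟨by positivity, by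
      rw [div_le_one (by positivity)]
      exact le_add_of_nonneg_left n.cast_nonneg⟩
  have hεpos : ∀ n, ε n ∈ Set.Ioc 0 ε₀ := fun n => by
    have h := hq n
    exact ⟨mul_pos hε₀ (pow_pos h.1 2), mul_le_of_le_one_right hε₀.le (pow_le_one₀ h.1.le h.2)⟩
  have hτpos : ∀ n, 0 < τ n ∧ τ n ≤ T := fun n =>
    ⟨mul_pos hT (hq n).1, mul_le_of_le_one_right hT.le (hq n).2⟩
  have hq0 := tendsto_one_div_add_atTop_nhds_zero_nat (𝕜 := ℝ)
  have hε0 : Filter.Tendsto ε Filter.atTop (nhds 0) := by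
    simpa [ε] using (hq0.pow 2).const_mul ε₀
  have hτ0 : Filter.Tendsto τ Filter.atTop (nhds 0) := by
    simpa [τ] using hq0.const_mul T
  have hpoint : ∀ n, ∃ x ∈ N \ L, c - ε n ≤ f x ∧ (∀ i, x ∉ U i) ∧
      (∀ s ∈ Set.Icc 0 T, φ s x ∈ N \ L) ∧ f (φ T x) < c + ε n := by
    intro n
    obtain ⟨ξ, hξ, hξT, hξU⟩ := H (ε n) (hεpos n)
    rcases hξ with rfl | ⟨x, hx, hfx, rfl⟩
    · refine absurd (Or.inl (hψ2 T hT.le _ fun h => ?_)) hξT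
      have h' := (h 0 ⟨le_rfl, hT.le⟩).2
      rw [hφ0] at h'
      exact h' hl₀
    · have hstay : ∀ s ∈ Set.Icc 0 T, φ s (x : E) ∈ N \ L := by
        by_contra h
        exact hξT (Or.inl (hψ2 T hT.le x h))
      refine ⟨x, hx, hfx, fun i hi => hξU i x hi rfl, hstay, ?_⟩
      by_contra! h
      exact hξT (Or.inr ⟨_, hstay T ⟨hT.le, le_rfl⟩, h, (hψ1 T hT.le x hstay).symm⟩)
  choose x hxNL hxlow hxU hxstay hxhigh using hpoint
  have htime : ∀ n, ∃ t ∈ Set.Ioo 0 (τ n),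
      α ‖fderiv ℝ f (φ t (x n))‖ ≤ 2 * ε n / τ n := by
    intro n
    obtain ⟨t, ht, hslope⟩ := exists_hasDerivAt_eq_slope (fun s => f (φ s (x n)))
      (fun t => fderiv ℝ f (φ t (x n)) (Y (φ t (x n)))) (hτpos n).1
      (fun s _ => (hderiv (x n) s).continuousAt.continuousWithinAt) fun s _ => hderiv (x n) s
    refine ⟨t, ht, (hYg _).trans ?_⟩
    have h1 := hmono (x n) (hτpos n).2
    have h2 := hxlow n
    have h3 := hxhigh n
    rw [hslope, sub_zero, hφ0]
    refine div_le_div_of_nonneg_right ?_ (hτpos n).1.le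
    simp only at h1
    linarith
  choose t ht hαt using htime
  let z : ℕ → E := fun n => φ (t n) (x n)
  have htT : ∀ n, t n ∈ Set.Icc 0 T := fun n => ⟨(ht n).1.le, (ht n).2.le.trans (hτpos n).2⟩
  have hzV : ∀ n, z n ∈ closure (N \ L) := fun n => subset_closure (hxstay n _ (htT n))
  have ht0 : Filter.Tendsto t Filter.atTop (nhds 0) :=
    squeeze_zero (fun n => (htT n).1) (fun n => (ht n).2.le) hτ0
  have hxz : Filter.Tendsto (fun n => z n - x n) Filter.atTop (nhds 0) :=
    squeeze_zero_norm (fun n => hdist _ _ (htT n).1) (by simpa using ht0.const_mul C)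
  have hfz : Filter.Tendsto (fun n => f (z n)) Filter.atTop (nhds c) := by
    refine tendsto_of_tendsto_of_tendsto_of_le_of_le (g := fun n => c - ε n)
      (h := fun n => c + ε n) (by simpa using hε0.const_sub c) (by simpa using hε0.const_add c)
      (fun n => ?_) fun n => ((hmono (x n) (htT n).2).trans (hxhigh n).le)
    have h := hmono (x n) (htT n).1
    simp only [hφ0] at h
    exact (hxlow n).trans h
  have hratio : Filter.Tendsto (fun n => 2 * ε n / τ n) Filter.atTop (nhds 0) := by
    have h : ∀ n : ℕ, 2 * ε n / τ n = 2 * ε₀ / T * (1 / ((n : ℝ) + 1)) := fun n => by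
      have : (n : ℝ) + 1 ≠ 0 := by positivity
      simp only [ε, τ]
      field_simp
    simp only [h]
    simpa using hq0.const_mul (2 * ε₀ / T)
  have hDfz : Filter.Tendsto (fun n => ‖fderiv ℝ f (z n)‖) Filter.atTop (nhds 0) := by
    rw [Metric.tendsto_atTop']
    intro δ hδ
    have hαδ : 0 < α δ := hα3 ▸ hα1 (Set.mem_Ici.2 le_rfl) (Set.mem_Ici.2 hδ.le) hδ
    obtain ⟨M, hM⟩ := Filter.eventually_atTop.1 (hratio.eventually_lt_const hαδ)
    refine ⟨M, fun n hn => ?_⟩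
    rw [Real.dist_eq, sub_zero, abs_of_nonneg (norm_nonneg _)]
    exact (hα1.lt_iff_lt (Set.mem_Ici.2 (norm_nonneg _)) (Set.mem_Ici.2 hδ.le)).1
      ((hαt n).trans_lt (hM n hn.le))
  obtain ⟨p, σ, hσ, hzp⟩ := hPS z hzV (hfb.imp fun K hK n => hK _ (hzV n)) hDfz
  have hfp : f p = c :=
    tendsto_nhds_unique ((hf.continuous.tendsto p).comp hzp) (hfz.comp hσ.tendsto_atTop)
  have hDfp : fderiv ℝ f p = 0 := norm_eq_zero.1 <|
    tendsto_nhds_unique (((hf.continuous_fderiv one_ne_zero).norm.tendsto p).comp hzp)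
      (hDfz.comp hσ.tendsto_atTop)
  have hpV : p ∈ closure (N \ L) :=
    isClosed_closure.mem_of_tendsto hzp (Filter.Eventually.of_forall fun n => hzV _)
  obtain ⟨i, rfl⟩ := (hcrit p).1
    ⟨hpV, ⟨by rw [hfp]; linarith, by rw [hfp]; linarith⟩, hDfp⟩
  have hxp : Filter.Tendsto (x ∘ σ) Filter.atTop (nhds (y i)) := by
    have h := hzp.sub (hxz.comp hσ.tendsto_atTop)
    simpa [Function.comp_def] using h
  have hxN : Filter.Tendsto (x ∘ σ) Filter.atTop (nhdsWithin (y i) N) :=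
    tendsto_nhdsWithin_iff.2 ⟨hxp, Filter.Eventually.of_forall fun n => (hxNL _).1⟩
  obtain ⟨n, hn⟩ := (hxN.eventually (hU2 i)).exists
  exact hxU (σ n) i hn
end

section
/- Under the Section 4 setup (pseudo-gradient flow φ for f on a Banach space E, index pair (N,L) with V = cl(N − L), f bounded on V, Palais–Smale in V, no critical points of f in L ∩ V), suppose x_1, …, x_n are exactly the critical points of f in V, and for each i let U_i be a neighborhood of x_i in N with U_i ⊆ N − L. Then there exist t_0, t_1, …, t_n ≥ 0 such that N/L = (φ_♯^{t_0})^{-1}({[L]}) ∪ ⋃_{i=1}^n (φ_♯^{t_i})^{-1}(π(U_i)). -/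
open Set Filter Topology

/-- A continuous real function rising from at most `r` to at least `R` on `[a, b]` has a
subinterval on whose interior it lies strictly between `r` and `R`. -/
theorem exists_crossing {g : ℝ → ℝ} (hg : Continuous g) {a b r R : ℝ} (hab : a ≤ b)
    (ha : g a ≤ r) (hb : R ≤ g b) :
    ∃ s t, a ≤ s ∧ s ≤ t ∧ t ≤ b ∧ g s ≤ r ∧ R ≤ g t ∧ ∀ u ∈ Ioo s t, r < g u ∧ g u < R := by
  obtain ⟨t, ⟨⟨hat, htb⟩, hRt⟩, htmin⟩ :=
    (isCompact_Icc.inter_right (isClosed_Ici.preimage hg) :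
      IsCompact (Icc a b ∩ g ⁻¹' Ici R)).exists_isLeast ⟨b, ⟨hab, le_rfl⟩, hb⟩
  obtain ⟨s, ⟨⟨has, hst⟩, hsr⟩, hsmax⟩ :=
    (isCompact_Icc.inter_right (isClosed_Iic.preimage hg) :
      IsCompact (Icc a t ∩ g ⁻¹' Iic r)).exists_isGreatest ⟨a, ⟨le_rfl, hat⟩, ha⟩
  refine ⟨s, t, has, hst, htb, hsr, hRt, fun u hu => ⟨?_, ?_⟩⟩
  · by_contra! h
    exact absurd (hsmax ⟨⟨has.trans hu.1.le, hu.2.le⟩, h⟩) (not_le.2 hu.1)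
  · by_contra! h
    exact absurd (htmin ⟨⟨has.trans hu.1.le, hu.2.le.trans htb⟩, h⟩) (not_le.2 hu.2)

section Curve

variable {E : Type*} [NormedAddCommGroup E] [NormedSpace ℝ E] {f : E → ℝ} {p v : ℝ → E}

theorem mul_sub_le_image_sub_of_le_fderiv_along (hf : Differentiable ℝ f)
    (hp : ∀ t, HasDerivAt p (v t) t) {a b c : ℝ} (hab : a ≤ b)
    (h : ∀ u ∈ Ioo a b, c ≤ fderiv ℝ f (p u) (v u)) :
    c * (b - a) ≤ f (p b) - f (p a) := by
  have hd : ∀ t, HasDerivAt (fun s => f (p s)) (fderiv ℝ f (p t) (v t)) t := fun t =>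
    (hf (p t)).hasFDerivAt.comp_hasDerivAt t (hp t)
  refine (convex_Icc a b).mul_sub_le_image_sub_of_le_deriv (f := fun s => f (p s))
    (fun t _ => (hd t).continuousAt.continuousWithinAt)
    (fun t _ => (hd t).differentiableAt.differentiableWithinAt) (fun u hu => ?_)
    a ⟨le_rfl, hab⟩ b ⟨hab, le_rfl⟩ hab
  rw [interior_Icc] at hu
  rw [(hd u).deriv]
  exact h u hu

/-- A curve of speed at most `M` which crosses the annulus `r < ‖· - y‖ < R`, on which `f` grows at
rate at least `c` along the curve, gains at least `c * ((R - r) / M)`. -/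
theorem gain_of_crossing (hf : Differentiable ℝ f) (hp : ∀ t, HasDerivAt p (v t) t)
    {M : ℝ} (hM : 0 < M) (hv : ∀ t, ‖v t‖ ≤ M) (hmono : ∀ t, 0 ≤ fderiv ℝ f (p t) (v t))
    {y : E} {r R c a b : ℝ} (hab : a ≤ b) (hc : 0 ≤ c)
    (ha : ‖p a - y‖ ≤ r) (hb : R ≤ ‖p b - y‖)
    (h : ∀ u ∈ Icc a b, r ≤ ‖p u - y‖ → ‖p u - y‖ ≤ R → c ≤ fderiv ℝ f (p u) (v u)) :
    c * ((R - r) / M) ≤ f (p b) - f (p a) := by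
  have hpc : Continuous p := continuous_iff_continuousAt.2 fun t => (hp t).continuousAt
  obtain ⟨s, t, has, hst, htb, hs, ht, hu⟩ :=
    exists_crossing (g := fun u => ‖p u - y‖) (by fun_prop) hab ha hb
  have h1 := mul_sub_le_image_sub_of_le_fderiv_along hf hp (c := 0) has fun u _ => hmono u
  have h2 := mul_sub_le_image_sub_of_le_fderiv_along hf hp (c := 0) htb fun u _ => hmono u
  have h3 := mul_sub_le_image_sub_of_le_fderiv_along hf hp (c := c) hst fun u hu' =>
    h u ⟨has.trans hu'.1.le, hu'.2.le.trans htb⟩ (hu u hu').1.le (hu u hu').2.le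
  have h4 : ‖p t - p s‖ ≤ M * (t - s) :=
    norm_image_sub_le_of_norm_deriv_le_segment' (fun u _ => (hp u).hasDerivWithinAt)
      (fun u _ => hv u) t ⟨hst, le_rfl⟩
  have h5 : R - r ≤ ‖p t - p s‖ := by
    have := norm_sub_le_norm_sub_add_norm_sub (p t) (p s) y
    linarith
  have h6 : (R - r) / M ≤ t - s := by
    rw [div_le_iff₀ hM]
    linarith
  have h7 := mul_le_mul_of_nonneg_left h6 hc
  linarith

/-- Under a Palais–Smale condition, the derivative is bounded away from zero on closed sets
without critical points. -/
theorem exists_pos_le_norm_fderiv (hf : ContDiff ℝ 1 f) {V A : Set E} (hA : IsClosed A)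
    (hAV : A ⊆ V) (hfb : ∃ C, ∀ x ∈ V, |f x| ≤ C)
    (hPS : ∀ u : ℕ → E, (∀ n, u n ∈ V) → (∃ C, ∀ n, |f (u n)| ≤ C) →
      Tendsto (fun n => ‖fderiv ℝ f (u n)‖) atTop (𝓝 0) →
      ∃ x : E, ∃ σ : ℕ → ℕ, StrictMono σ ∧ Tendsto (u ∘ σ) atTop (𝓝 x))
    (hcrit : ∀ z ∈ A, fderiv ℝ f z ≠ 0) :
    ∃ δ > 0, ∀ z ∈ A, δ ≤ ‖fderiv ℝ f z‖ := by
  by_contra! h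
  choose u huA hu using fun n : ℕ => h (1 / ((n : ℝ) + 1)) Nat.one_div_pos_of_nat
  have h0 : Tendsto (fun n => ‖fderiv ℝ f (u n)‖) atTop (𝓝 0) :=
    squeeze_zero (fun _ => norm_nonneg _) (fun n => (hu n).le) tendsto_one_div_add_atTop_nhds_zero_nat
  obtain ⟨C, hC⟩ := hfb
  obtain ⟨z, σ, hσ, hz⟩ := hPS u (fun n => hAV (huA n)) ⟨C, fun n => hC _ (hAV (huA n))⟩ h0
  refine hcrit z (hA.mem_of_tendsto hz (Eventually.of_forall fun n => huA _)) ?_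
  have hcont : Continuous fun z => ‖fderiv ℝ f z‖ := (hf.continuous_fderiv one_ne_zero).norm
  exact norm_eq_zero.1 (tendsto_nhds_unique ((hcont.tendsto z).comp hz)
    (h0.comp hσ.tendsto_atTop))

end Curve

theorem stmt16
    {E : Type*} [NormedAddCommGroup E] [NormedSpace ℝ E] [CompleteSpace E]
    (f : E → ℝ) (hf : ContDiff ℝ 1 f)
    -- α : [0,∞) → [0,∞) is strictly increasing and continuous with α(0) = 0
    (α : ℝ → ℝ) (hα1 : StrictMonoOn α (Set.Ici 0))
    (hα2 : ContinuousOn α (Set.Ici 0)) (hα3 : α 0 = 0)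
    (hα4 : ∀ r : ℝ, 0 ≤ r → 0 ≤ α r)
    -- Y is a pseudo-gradient vector field for f
    (Y : E → E) (hYb : ∃ C, ∀ x, ‖Y x‖ ≤ C)
    (hYg : ∀ x, α ‖fderiv ℝ f x‖ ≤ fderiv ℝ f x (Y x))
    (hY0 : ∀ x, fderiv ℝ f x = 0 → Y x = 0)
    -- φ is the flow of Y
    (φ : ℝ → E → E)
    (hφc : Continuous fun p : ℝ × E => φ p.1 p.2)
    (hφ0 : ∀ x, φ 0 x = x)
    (hφadd : ∀ s t x, φ (s + t) x = φ s (φ t x))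
    (hφode : ∀ x t, HasDerivAt (fun s : ℝ => φ s x) (Y (φ t x)) t)
    -- (N, L) is an index pair: closed, (i), (ii), cl(N − L) isolating
    (N L : Set E) (hN : IsClosed N) (hL : IsClosed L) (hLN : L ⊆ N)
    (hpos : ∀ x ∈ L, ∀ t ≥ (0 : ℝ), (∀ s ∈ Set.Icc 0 t, φ s x ∈ N) →
      ∀ s ∈ Set.Icc 0 t, φ s x ∈ L)
    (hexit : ∀ x ∈ N, ¬ (∀ t ≥ (0 : ℝ), φ t x ∈ N) →
      ∃ t ≥ (0 : ℝ), (∀ s ∈ Set.Icc 0 t, φ s x ∈ N) ∧ φ t x ∈ L)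
    (hiso : ∀ x ∈ closure (N \ L), (∀ t : ℝ, φ t x ∈ closure (N \ L)) →
      x ∈ interior (closure (N \ L)))
    -- f is bounded on V = cl(N − L)
    (hfb : ∃ C, ∀ x ∈ closure (N \ L), |f x| ≤ C)
    -- f satisfies the Palais–Smale condition in V
    (hPS : ∀ u : ℕ → E, (∀ n, u n ∈ closure (N \ L)) →
      (∃ C, ∀ n, |f (u n)| ≤ C) →
      Filter.Tendsto (fun n => ‖fderiv ℝ f (u n)‖) Filter.atTop (nhds 0) →
      ∃ x : E, ∃ σ : ℕ → ℕ, StrictMono σ ∧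
        Filter.Tendsto (u ∘ σ) Filter.atTop (nhds x))
    -- f has no critical points in L ∩ V
    (hnc : ∀ x ∈ L ∩ closure (N \ L), fderiv ℝ f x ≠ 0)
    -- the point [L] in N/L and the induced semiflow φ♯ on N/L
    (l₀ : E) (hl₀ : l₀ ∈ L)
    (ψ : ℝ → Quotient (collapse N L) → Quotient (collapse N L))
    (hψ1 : ∀ t : ℝ, ∀ ht : 0 ≤ t, ∀ x : N,
      ∀ h : (∀ s ∈ Set.Icc 0 t, φ s (x : E) ∈ N \ L),
      ψ t (Quotient.mk (collapse N L) x) =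
        Quotient.mk (collapse N L) ⟨φ t (x : E), (h t ⟨ht, le_rfl⟩).1⟩)
    (hψ2 : ∀ t : ℝ, 0 ≤ t → ∀ x : N,
      ¬ (∀ s ∈ Set.Icc 0 t, φ s (x : E) ∈ N \ L) →
      ψ t (Quotient.mk (collapse N L) x) = Quotient.mk (collapse N L) ⟨l₀, hLN hl₀⟩)
    (n : ℕ)
    -- x 1, …, x n are exactly the critical points of f in V
    (x : Fin n → E) (hxinj : Function.Injective x)
    (hcrit : ∀ z : E, (z ∈ closure (N \ L) ∧ fderiv ℝ f z = 0) ↔ ∃ i, x i = z)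
    -- U i ⊆ N − L is a neighborhood of x i in N
    (U : Fin n → Set E) (hU1 : ∀ i, U i ⊆ N \ L)
    (hU2 : ∀ i, U i ∈ nhdsWithin (x i) N) :
    ∃ t : Fin (n + 1) → ℝ, (∀ i, 0 ≤ t i) ∧
      ∀ ξ : Quotient (collapse N L),
        ψ (t 0) ξ = Quotient.mk (collapse N L) ⟨l₀, hLN hl₀⟩ ∨
        ∃ i : Fin n, ∃ z : N, (z : E) ∈ U i ∧
          Quotient.mk (collapse N L) z = ψ (t i.succ) ξ := by
  have hVN : closure (N \ L) ⊆ N := closure_minimal sdiff_subset hN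
  have hfd : Differentiable ℝ f := hf.differentiable one_ne_zero
  have hα0 : ∀ d, 0 < d → 0 < α d := fun d hd => by
    simpa [hα3] using hα1 (by simp) (mem_Ici.2 hd.le) hd
  have hrate : ∀ d, 0 < d → ∀ z, d ≤ ‖fderiv ℝ f z‖ → α d ≤ fderiv ℝ f z (Y z) := fun d hd z hz =>
    (hα1.monotoneOn (mem_Ici.2 hd.le) (norm_nonneg _) hz).trans (hYg z)
  have hmono : ∀ z, 0 ≤ fderiv ℝ f z (Y z) := fun z => (hα4 _ (norm_nonneg _)).trans (hYg z)
  obtain ⟨M, hM, hYM⟩ : ∃ M > 0, ∀ z, ‖Y z‖ ≤ M := by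
    obtain ⟨C, hC⟩ := hYb
    exact ⟨max C 1, by positivity, fun z => (hC z).trans (le_max_left _ _)⟩
  -- an orbit in `V` which leaves `U i` after being close to `x i` gains a definite amount
  have hleave : ∀ i, ∃ r > 0, ∃ γ > 0, ∀ z a b, a ≤ b →
      (∀ u ∈ Icc a b, φ u z ∈ closure (N \ L)) → ‖φ a z - x i‖ ≤ r → φ b z ∉ U i →
      γ ≤ f (φ b z) - f (φ a z) := by
    intro i
    obtain ⟨ρ₁, hρ₁, hball₁⟩ := Metric.mem_nhdsWithin_iff.1 (hU2 i)
    have hfin : (range x \ {x i}).Finite := (finite_range x).subset sdiff_subset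
    obtain ⟨ρ₂, hρ₂, hball₂⟩ := Metric.mem_nhds_iff.1
      (hfin.isClosed.isOpen_compl.mem_nhds (show x i ∈ (range x \ {x i})ᶜ by simp))
    set R := min ρ₁ ρ₂ / 2 with hR
    have hR0 : 0 < R := by positivity
    have hR₁ : R < ρ₁ := by have := min_le_left ρ₁ ρ₂; have := lt_min hρ₁ hρ₂; linarith
    have hR₂ : R < ρ₂ := by have := min_le_right ρ₁ ρ₂; have := lt_min hρ₁ hρ₂; linarith
    obtain ⟨δ, hδ, hδA⟩ := exists_pos_le_norm_fderiv hf
      (A := closure (N \ L) ∩ {w | R / 2 ≤ ‖w - x i‖ ∧ ‖w - x i‖ ≤ R})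
      (isClosed_closure.inter <|
        (isClosed_le continuous_const (continuous_id.sub continuous_const).norm).inter
          (isClosed_le (continuous_id.sub continuous_const).norm continuous_const)) inter_subset_left hfb hPS (by
        rintro w ⟨hwV, hw1, hw2⟩ hw0
        have hwr : w ∈ range x := (hcrit w).1 ⟨hwV, hw0⟩
        have hwb : w ∈ Metric.ball (x i) ρ₂ := by
          rw [mem_ball_iff_norm]
          linarith
        refine hball₂ hwb ⟨hwr, ?_⟩
        rintro rfl
        simp only [sub_self, norm_zero] at hw1
        linarith)
    refine ⟨R / 2, by positivity, α δ * ((R - R / 2) / M), ?_, ?_⟩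
    · have := hα0 δ hδ
      have : 0 < R - R / 2 := by linarith
      positivity
    · intro z a b hab hV ha hb
      refine gain_of_crossing (p := fun t => φ t z) (v := fun t => Y (φ t z)) (y := x i) hfd
        (hφode z) hM (fun t => hYM _) (fun t => hmono _) hab (hα0 δ hδ).le ha ?_
        fun u hu h1 h2 => hrate δ hδ _ (hδA _ ⟨hV u hu, h1, h2⟩)
      by_contra! h
      refine hb (hball₁ ⟨?_, hVN (hV b ⟨hab, le_rfl⟩)⟩)
      rw [mem_ball_iff_norm]
      linarith
  choose r hr γ hγ hgain using hleave
  obtain ⟨ε, hεγ, hε⟩ : ∃ ε : ℝ, (∀ i, 2 * ε ≤ γ i) ∧ 0 < ε := by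
    have h : ∀ᶠ ε : ℝ in 𝓝[>] 0, ∀ i, 2 * ε ≤ γ i := eventually_all.2 fun i => by
      filter_upwards [nhdsWithin_le_nhds (Iio_mem_nhds (half_pos (hγ i)))] with ε hε
      have := mem_Iio.1 hε
      linarith
    exact (h.and self_mem_nhdsWithin).exists
  let W : Fin n → Set E := fun i => {w | ‖w - x i‖ < r i ∧ |f w - f (x i)| < ε}
  have hW : ∀ i, IsOpen (W i) := fun i =>
    (isOpen_lt (continuous_id.sub continuous_const).norm continuous_const).inter
      (isOpen_lt (hf.continuous.sub continuous_const).abs continuous_const)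
  -- every orbit segment in `V` of duration `T` meets some `W i`
  obtain ⟨T, hT, hhit⟩ : ∃ T > 0, ∀ z a, (∀ u ∈ Icc a (a + T), φ u z ∈ closure (N \ L)) →
      ∃ u ∈ Icc a (a + T), ∃ i, φ u z ∈ W i := by
    obtain ⟨δ, hδ, hδA⟩ := exists_pos_le_norm_fderiv hf
      (A := closure (N \ L) \ ⋃ i, W i)
      (isClosed_closure.sdiff (isOpen_iUnion hW)) sdiff_subset hfb hPS (by
        rintro w ⟨hwV, hw⟩ hw0
        obtain ⟨i, rfl⟩ := (hcrit w).1 ⟨hwV, hw0⟩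
        exact hw (mem_iUnion.2 ⟨i, by simp [W, hr, hε]⟩))
    obtain ⟨C, hC⟩ := hfb
    have hc := hα0 δ hδ
    have hC' : 0 ≤ max C 0 := le_max_right _ _
    refine ⟨(2 * max C 0 + 1) / α δ, by positivity, fun z a hV => ?_⟩
    set T := (2 * max C 0 + 1) / α δ with hTdef
    have hT : 0 ≤ T := by positivity
    by_contra! hno
    have h1 := mul_sub_le_image_sub_of_le_fderiv_along (p := fun t => φ t z)
      (v := fun t => Y (φ t z)) (c := α δ) hfd (hφode z) (le_add_of_nonneg_right hT : a ≤ a + T)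
      fun u hu => hrate δ hδ _ (hδA _ ⟨hV u (Ioo_subset_Icc_self hu), by
        simpa using hno u (Ioo_subset_Icc_self hu)⟩)
    have h2 : α δ * (a + T - a) = 2 * max C 0 + 1 := by
      rw [add_sub_cancel_left, hTdef]
      field_simp
    have h3 := abs_le.1 (hC _ (hV a ⟨le_rfl, by linarith⟩))
    have h4 := abs_le.1 (hC _ (hV (a + T) ⟨by linarith, le_rfl⟩))
    have h5 := le_max_left C 0
    linarith [h3.1, h4.2]
  -- the rank of the critical value `f (x i)`
  let k : Fin n → ℕ := fun i => (Finset.univ.filter fun j => f (x j) ≤ f (x i)).card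
  have hk1 : ∀ i, 1 ≤ k i := fun i => Finset.card_pos.2 ⟨i, by simp⟩
  have hkn : ∀ i, k i ≤ n := fun i => (Finset.card_filter_le _ _).trans (by simp)
  have hklt : ∀ i j, f (x i) < f (x j) → k i < k j := fun i j hij => by
    refine Finset.card_lt_card (Finset.ssubset_iff_of_subset ?_ |>.2 ⟨j, by simp, by simpa using hij⟩)
    intro l hl
    simp only [Finset.mem_filter, Finset.mem_univ, true_and] at hl ⊢
    exact hl.trans hij.le
  refine ⟨Fin.cons (((n : ℝ) + 1) * T) fun i => (k i : ℝ) * T, ?_, ?_⟩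
  · intro i
    refine Fin.cases ?_ (fun i => ?_) i <;> simp only [Fin.cons_zero, Fin.cons_succ] <;> positivity
  intro ξ
  obtain ⟨z, rfl⟩ := Quotient.exists_rep ξ
  simp only [Fin.cons_zero, Fin.cons_succ]
  by_cases hstay : ∀ s ∈ Icc 0 (((n : ℝ) + 1) * T), φ s (z : E) ∈ N \ L
  swap
  · exact Or.inl (hψ2 _ (by positivity) z hstay)
  right
  by_contra! hnot
  have hkT : ∀ i, (k i : ℝ) * T ≤ ((n : ℝ) + 1) * T := fun i => by
    have : (k i : ℝ) ≤ n := by exact_mod_cast hkn i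
    gcongr
    linarith
  have hout : ∀ i, φ ((k i : ℝ) * T) z ∉ U i := fun i hi => by
    have hs : ∀ s ∈ Icc 0 ((k i : ℝ) * T), φ s (z : E) ∈ N \ L := fun s hs =>
      hstay s ⟨hs.1, hs.2.trans (hkT i)⟩
    exact hnot i ⟨φ ((k i : ℝ) * T) z, (hU1 i hi).1⟩ hi (hψ1 _ (by positivity) z hs).symm
  have key : ∀ m : ℕ, m ≤ n →
      ∃ s ∈ Icc (0 : ℝ) (((m : ℝ) + 1) * T), ∃ i, φ s z ∈ W i ∧ m < k i := by
    intro m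
    induction m with
    | zero =>
      intro _
      obtain ⟨u, hu, i, hi⟩ := hhit z 0 fun u hu => subset_closure (hstay u ⟨hu.1, by
        have : 0 ≤ (n : ℝ) * T := by positivity
        linarith [hu.2]⟩)
      exact ⟨u, by simpa using hu, i, hi, hk1 i⟩
    | succ m ih =>
      intro hmn
      have hmn' : (m : ℝ) + 1 ≤ n := by exact_mod_cast hmn
      obtain ⟨s, hs, i, hi, hmi⟩ := ih (by omega)
      push_cast
      rcases (Nat.succ_le_of_lt hmi).lt_or_eq with hlt | heq
      · exact ⟨s, ⟨hs.1, hs.2.trans (by gcongr; linarith)⟩, i, hi, hlt⟩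
      have hki : (k i : ℝ) = m + 1 := by rw [← heq]; push_cast; rfl
      have hend : ((m : ℝ) + 1) * T + T ≤ ((n : ℝ) + 1) * T := by
        have : ((m : ℝ) + 1) * T ≤ n * T := by gcongr
        linarith
      have hg := hgain i z s ((k i : ℝ) * T) (hki ▸ hs.2)
        (fun u hu => subset_closure (hstay u ⟨hs.1.trans hu.1, hu.2.trans (hkT i)⟩))
        hi.1.le (hout i)
      rw [hki] at hg
      have h0 : 0 ≤ ((m : ℝ) + 1) * T := by positivity
      obtain ⟨u, hu, j, hj⟩ := hhit z (((m : ℝ) + 1) * T) fun u hu =>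
        subset_closure (hstay u ⟨h0.trans hu.1, hu.2.trans hend⟩)
      have hmu := mul_sub_le_image_sub_of_le_fderiv_along (p := fun t => φ t z)
        (v := fun t => Y (φ t z)) (c := 0) hfd (hφode z) hu.1 fun u _ => hmono _
      refine ⟨u, ⟨h0.trans hu.1, hu.2.trans (by linarith)⟩, j, hj, ?_⟩
      rw [Nat.succ_eq_add_one] at heq
      rw [heq]
      refine hklt i j ?_
      have h1 := abs_lt.1 hi.2
      have h2 := abs_lt.1 hj.2
      have h3 := hεγ i
      linarith [h1.1, h2.2]
  obtain ⟨s, -, i, -, hni⟩ := key n le_rfl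
  exact absurd (hkn i) (not_le.2 hni)
end
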